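/- Let g = gl_∞ with either of its two (up to conjugacy) Dynkin Borel subalgebras b. Then the second extension space of the trivial module by itself in category O is infinite dimensional: dim_k Ext²_O(k, k) = ∞. -/

import Mathlib

set_option linter.unusedSectionVars false

open UniversalEnvelopingAlgebra

noncomputable section

attribute [local instance 100] LieRing.ofAssociativeRing

universe u

variable (K : Type) [Field K] [IsAlgClosed K] [CharZero K]
variable (g : Type) [LieRing g] [LieAlgebra K g]

/-- The weight space of a Lie module for a weight `χ` of a subalgebra `h`. -/
def wtSpace (h : LieSubalgebra K g) (M : Type) [AddCommGroup M] [Module K M]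
    [LieRingModule g M] [LieModule K g M] (χ : Module.Dual K h) : Submodule K M where
  carrier := {m | ∀ H : h, ⁅(H : g), m⁆ = χ H • m}
  add_mem' := by intro a b ha hb H; rw [lie_add, ha H, hb H, smul_add]
  zero_mem' := by intro H; rw [lie_zero, smul_zero]
  smul_mem' := by intro c m hm H; rw [lie_smul, hm H, smul_comm]

/-- The root space of `g` relative to `h` for the functional `α`. -/
abbrev rootSp (h : LieSubalgebra K g) (α : Module.Dual K h) : Submodule K g :=
  wtSpace K g h g α

/-- Notation for the universal enveloping algebra. -/
abbrev UEA (L : Type) [LieRing L] [LieAlgebra K L] : Type :=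
  UniversalEnvelopingAlgebra K L

variable {K} in
/-- The Lie module structure on a quotient of the universal enveloping algebra
by a left ideal. -/
instance uqLRM (L : Type) [LieRing L] [LieAlgebra K L]
    (I : Submodule (UEA K L) (UEA K L)) : LieRingModule L ((UEA K L) ⧸ I) where
  bracket x m := ι K x • m
  add_lie x y m := by
    show (ι K (x + y)) • m = (ι K x) • m + (ι K y) • m
    rw [map_add, add_smul]
  lie_add x m n := by
    show (ι K x) • (m + n) = (ι K x) • m + (ι K x) • n
    rw [smul_add]
  leibniz_lie x y m := by
    show (ι K x) • ((ι K y) • m) = (ι K ⁅x, y⁆) • m + (ι K y) • ((ι K x) • m)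
    rw [LieHom.map_lie, LieRing.of_associative_ring_bracket, sub_smul, mul_smul, mul_smul,
      sub_add_cancel]

variable {K} in
instance uqLM (L : Type) [LieRing L] [LieAlgebra K L]
    (I : Submodule (UEA K L) (UEA K L)) : LieModule K L ((UEA K L) ⧸ I) where
  smul_lie c x m := by
    show (ι K (c • x)) • m = c • ((ι K x) • m)
    rw [map_smul]
    exact smul_assoc c (ι K x) m
  lie_smul c x m := by
    show (ι K x) • (c • m) = c • ((ι K x) • m)
    exact smul_comm _ _ _

/-- A root-reductive Lie algebra together with a splitting Borel subalgebra `b ⊇ h`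
containing a fixed splitting maximal toral (Cartan) subalgebra `h`.  The fields record:
an exhausting chain `gc n` of nested finite-dimensional reductive subalgebras, each
reductive in the next, with compatible Cartan subalgebras and root vectors; the root
decomposition of `g` with respect to `h` with one-dimensional root spaces; a positive
system `Φp` closed under addition and the corresponding Borel subalgebra `b = h ⊕ n⁺`;
the anti-involution `τ`; coroots and the weight `ρ`. -/
structure RootReductive where
  h : LieSubalgebra K g
  gc : ℕ → LieSubalgebra K g
  gc_mono : Monotone gc
  gc_findim : ∀ n, FiniteDimensional K (gc n)
  gc_exhausts : ∀ x : g, ∃ n, x ∈ gc n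
  gc_reductive : ∀ n, LieAlgebra.radical K (gc n) = LieAlgebra.center K (gc n)
  gc_red_in : ∀ n, ∀ N : Submodule K g, N ≤ (gc (n+1)).toSubmodule →
      (∀ x ∈ gc n, ∀ v ∈ N, ⁅x, v⁆ ∈ N) →
      ∃ N' : Submodule K g, N' ≤ (gc (n+1)).toSubmodule ∧
        (∀ x ∈ gc n, ∀ v ∈ N', ⁅x, v⁆ ∈ N') ∧
        N ⊓ N' = ⊥ ∧ N ⊔ N' = (gc (n+1)).toSubmodule
  gc_cartan : ∀ n, ∃ hc : LieSubalgebra K (gc n),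
      ((hc : Set (gc n)) = ((↑) : (gc n) → g) ⁻¹' (h : Set g)) ∧ hc.IsCartanSubalgebra
  h_exhaust : ∀ x ∈ h, ∃ n, x ∈ gc n
  Φ : Set (Module.Dual K h)
  root_iff : ∀ α, α ∈ Φ ↔ α ≠ 0 ∧ rootSp K g h α ≠ ⊥
  root_dim : ∀ α ∈ Φ, Module.rank K (rootSp K g h α) = 1
  gc_rootdec : ∀ n, (gc n).toSubmodule =
      ((gc n).toSubmodule ⊓ h.toSubmodule) ⊔
        (⨆ α ∈ Φ, ((gc n).toSubmodule ⊓ rootSp K g h α))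
  rootdec : h.toSubmodule ⊔ (⨆ α ∈ Φ, rootSp K g h α) = ⊤
  Φp : Set (Module.Dual K h)
  pos_subset : Φp ⊆ Φ
  pos_union : Φ = Φp ∪ (-Φp)
  pos_disjoint : Disjoint Φp (-Φp)
  pos_add : ∀ α ∈ Φp, ∀ β ∈ Φp, α + β ∈ Φ → α + β ∈ Φp
  b : LieSubalgebra K g
  h_le_b : h ≤ b
  b_def : b.toSubmodule = h.toSubmodule ⊔ (⨆ α ∈ Φp, rootSp K g h α)
  np : LieSubalgebra K g
  np_def : np.toSubmodule = ⨆ α ∈ Φp, rootSp K g h α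
  nm : LieSubalgebra K g
  nm_def : nm.toSubmodule = ⨆ α ∈ Φp, rootSp K g h (-α)
  τ : g →ₗ[K] g
  τ_invol : ∀ x, τ (τ x) = x
  τ_anti : ∀ x y, τ ⁅x, y⁆ = ⁅τ y, τ x⁆
  τ_h : ∀ x ∈ h, τ x = x
  τ_root : ∀ (α : Module.Dual K h), ∀ x ∈ rootSp K g h α, τ x ∈ rootSp K g h (-α)
  coroot : Module.Dual K h → h
  coroot_two : ∀ α ∈ Φ, α (coroot α) = 2
  coroot_neg : ∀ α ∈ Φ, coroot (-α) = - coroot α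
  ρ : Module.Dual K h
  ρ_simple : ∀ α ∈ Φp, (¬ ∃ β ∈ Φp, ∃ γ ∈ Φp, β + γ = α) → ρ (coroot α) = 1

namespace RootReductive

variable {K g} (S : RootReductive K g)

/-- The nilradical `n⁺` of the Borel subalgebra, as a submodule. -/
def nplus : Submodule K g := ⨆ α ∈ S.Φp, rootSp K g S.h α

/-- `Γ⁺`: the additive monoid of sums of positive roots. -/
def Γp : AddSubmonoid (Module.Dual K S.h) := AddSubmonoid.closure S.Φp

/-- The order `μ ≤ λ` iff `λ - μ ∈ Γ⁺`. -/
def wle (μ lam : Module.Dual K S.h) : Prop := lam - μ ∈ S.Γp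

/-- The set of simple (positive) roots. -/
def simples : Set (Module.Dual K S.h) :=
  {α ∈ S.Φp | ¬ ∃ β ∈ S.Φp, ∃ γ ∈ S.Φp, β + γ = α}

/-- `b` is a Dynkin Borel subalgebra: every element of `Γ⁺` is a sum of simple roots. -/
def IsDynkin : Prop := ∀ α ∈ S.Φp, α ∈ AddSubmonoid.closure S.simples

/-- The finite-rank subalgebra `g_n = g̃_n + h`. -/
def gfull (n : ℕ) : LieSubalgebra K g := S.gc n ⊔ S.h

/-- The roots `Φ_n` of `g_n`. -/
def levelRoots (n : ℕ) : Set (Module.Dual K S.h) :=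
  {α ∈ S.Φ | rootSp K g S.h α ≤ (S.gfull n).toSubmodule}

/-- The root lattice `ℤΦ_n`. -/
def zrootsLevel (n : ℕ) : AddSubgroup (Module.Dual K S.h) :=
  AddSubgroup.closure (S.levelRoots n)

/-- The root lattice `ℤΦ`. -/
def zroots : AddSubgroup (Module.Dual K S.h) := AddSubgroup.closure S.Φ

/-- The partial order `≤_n` relative to the positive roots of `g_n`. -/
def wleLevel (n : ℕ) (μ lam : Module.Dual K S.h) : Prop :=
  lam - μ ∈ AddSubmonoid.closure (S.Φp ∩ S.levelRoots n)

/-- The defining left ideal of the Verma module `Δ(λ) = U(g)/I_λ`, where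
`I_λ` is generated by `n⁺` and the elements `H - λ(H)`, `H ∈ h`. -/
def vIdeal (lam : Module.Dual K S.h) : Submodule (UEA K g) (UEA K g) :=
  Submodule.span (UEA K g)
    ({u | ∃ x ∈ S.nplus, u = ι K x} ∪
     {u | ∃ H : S.h, u = ι K (H : g) - algebraMap K (UEA K g) (lam H)})

/-- The Verma module `Δ(λ)`. -/
abbrev Verma (lam : Module.Dual K S.h) : Type := (UEA K g) ⧸ S.vIdeal lam

/-- The left ideal corresponding to the maximal submodule of `Δ(λ)`. -/
def radIdeal (lam : Module.Dual K S.h) : Submodule (UEA K g) (UEA K g) :=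
  sSup {J | S.vIdeal lam ≤ J ∧ J ≠ ⊤}

/-- The simple highest weight module `L(λ)`, the unique simple quotient of `Δ(λ)`. -/
abbrev SimpleHW (lam : Module.Dual K S.h) : Type := (UEA K g) ⧸ S.radIdeal lam

/-- The defining left ideal of the Verma module of a subalgebra `h ≤ a`, relative to the
Borel subalgebra `a ∩ b`. -/
def vIdealSub (a : LieSubalgebra K g) (ha : S.h ≤ a) (lam : Module.Dual K S.h) :
    Submodule (UEA K a) (UEA K a) :=
  Submodule.span (UEA K a)
    ({u | ∃ x : a, (x : g) ∈ S.nplus ∧ u = ι K x} ∪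
     {u | ∃ H : S.h, u = ι K (⟨(H : g), ha H.2⟩ : a) - algebraMap K (UEA K a) (lam H)})

/-- The Verma module `Δ_a(λ)` of a subalgebra `h ≤ a ≤ g`. -/
abbrev VermaSub (a : LieSubalgebra K g) (ha : S.h ≤ a) (lam : Module.Dual K S.h) : Type :=
  (UEA K a) ⧸ S.vIdealSub a ha lam

def radIdealSub (a : LieSubalgebra K g) (ha : S.h ≤ a) (lam : Module.Dual K S.h) :
    Submodule (UEA K a) (UEA K a) :=
  sSup {J | S.vIdealSub a ha lam ≤ J ∧ J ≠ ⊤}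

/-- The simple highest weight module `L_a(λ)` of a subalgebra `h ≤ a ≤ g`. -/
abbrev SimpleHWSub (a : LieSubalgebra K g) (ha : S.h ≤ a) (lam : Module.Dual K S.h) : Type :=
  (UEA K a) ⧸ S.radIdealSub a ha lam

end RootReductive

/-- The subquotient `B/(A ∩ B)` of a module attached to two submodules `A ≤ B`. -/
abbrev subquot {R M : Type} [Ring R] [AddCommGroup M] [Module R M]
    (A B : Submodule R M) : Type :=
  B ⧸ (A.comap B.subtype)

/-- The multiplicity `[M : N]` of a module `N` in a module `M`: the supremum, over all
finite filtrations of `M`, of the number of subquotients isomorphic to `N`. -/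
noncomputable def jhMult (R M N : Type) [Ring R] [AddCommGroup M] [Module R M]
    [AddCommGroup N] [Module R N] : Cardinal.{0} :=
  ⨆ (n : ℕ), ⨆ (F : Fin (n+1) →o Submodule R M),
    ⨆ (_ : F 0 = ⊥ ∧ F (Fin.last n) = ⊤),
      (Nat.card {i : Fin n //
        Nonempty ((subquot (F i.castSucc) (F i.succ)) ≃ₗ[R] N)} : Cardinal)

/-- The `K`-vector space structure on the space of `U(L)`-module homomorphisms,
via the central embedding `K → U(L)`. -/
def homKModule (L : Type) [LieRing L] [LieAlgebra K L] (M N : Type)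
    [AddCommGroup M] [Module (UEA K L) M] [AddCommGroup N] [Module (UEA K L) N] :
    Module K (M →ₗ[UEA K L] N) :=
  letI : Module K N := Module.compHom N (algebraMap K (UEA K L))
  letI : SMulCommClass (UEA K L) K N :=
    ⟨fun u c n => by
      show u • ((algebraMap K (UEA K L) c) • n) = (algebraMap K (UEA K L) c) • (u • n)
      rw [smul_smul, smul_smul, Algebra.commutes]⟩
  inferInstance

/-- The dimension over `K` of the space of `U(L)`-module homomorphisms. -/
noncomputable def homDim (L : Type) [LieRing L] [LieAlgebra K L] (M N : Type)
    [AddCommGroup M] [Module (UEA K L) M] [AddCommGroup N] [Module (UEA K L) N] :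
    Cardinal :=
  letI := homKModule K L M N
  Module.rank K (M →ₗ[UEA K L] N)

namespace RootReductive

variable {K g} (S : RootReductive K g)

/-- The weight set of weight `χ` of a `U(g)`-module. -/
def wtSet (M : Type) [AddCommGroup M] [Module (UEA K g) M]
    (χ : Module.Dual K S.h) : Set M :=
  {m | ∀ H : S.h, (ι K (H : g)) • m = (algebraMap K (UEA K g) (χ H)) • m}

/-- A `U(g)`-module is a weight module (i.e. semisimple as an `h`-module) if it is the
sum of its weight spaces. -/
def IsWeightMod (M : Type) [AddCommGroup M] [Module (UEA K g) M] : Prop :=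
  ∀ m : M, m ∈ AddSubgroup.closure (⋃ χ : Module.Dual K S.h, S.wtSet M χ)

/-- The support of a module: the set of weights whose weight space is non-zero. -/
def suppSet (M : Type) [AddCommGroup M] [Module (UEA K g) M] :
    Set (Module.Dual K S.h) :=
  {χ | ∃ m ∈ S.wtSet M χ, m ≠ 0}

/-- Local finiteness of the action of the Borel subalgebra `b`:
every vector lies in a finite-dimensional `b`-stable subspace. -/
def IsLocFin (M : Type) [AddCommGroup M] [Module (UEA K g) M] : Prop :=
  letI : Module K M := Module.compHom M (algebraMap K (UEA K g))
  ∀ m : M, ∃ N : Submodule K M, m ∈ N ∧ FiniteDimensional K N ∧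
    ∀ x ∈ S.b, ∀ v ∈ N, (ι K x) • v ∈ N

/-- The module has finite-dimensional weight spaces. -/
def HasFinDimWt (M : Type) [AddCommGroup M] [Module (UEA K g) M] : Prop :=
  letI : Module K M := Module.compHom M (algebraMap K (UEA K g))
  ∀ χ : Module.Dual K S.h, ∃ s : Finset M,
    ↑s ⊆ S.wtSet M χ ∧ S.wtSet M χ ⊆ (Submodule.span K (s : Set M) : Set M)

/-- Membership in category `O`: a weight module with locally finite `b`-action. -/
def InO (M : Type) [AddCommGroup M] [Module (UEA K g) M] : Prop :=
  S.IsWeightMod M ∧ S.IsLocFin M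

/-- A subset of `h^*` is an ideal for the order `≤`. -/
def IsIdeal (A : Set (Module.Dual K S.h)) : Prop :=
  ∀ lam ∈ A, ∀ μ, S.wle μ lam → μ ∈ A

/-- A subset of `h^*` is upper finite. -/
def UpperFinite (A : Set (Module.Dual K S.h)) : Prop :=
  ∀ μ ∈ A, {lam ∈ A | S.wle μ lam}.Finite

/-- The dot action of a linear automorphism of `h^*`: `w · λ = w(λ+ρ) - ρ`. -/
def dot (w : Module.Dual K S.h ≃ₗ[K] Module.Dual K S.h)
    (lam : Module.Dual K S.h) : Module.Dual K S.h :=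
  w (lam + S.ρ) - S.ρ

/-- The dot action of the reflection `r_α`: `r_α · λ = λ - (λ+ρ)(Hα) α`. -/
def rdot (α lam : Module.Dual K S.h) : Module.Dual K S.h :=
  lam - ((lam + S.ρ) (S.coroot α)) • α

/-- One step of the Bruhat order: `μ = r_α · λ ≤ λ` for a positive root `α`. -/
def bruhatStep (μ lam : Module.Dual K S.h) : Prop :=
  ∃ α ∈ S.Φp, μ = S.rdot α lam ∧ S.wle μ lam

/-- The Bruhat order on `h^*`. -/
def bruhat : Module.Dual K S.h → Module.Dual K S.h → Prop :=
  Relation.ReflTransGen (fun μ lam => S.bruhatStep μ lam)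

/-- The set of reflections `r_α`, `α ∈ Φ`, as linear automorphisms of `h^*`. -/
def reflSet : Set (Module.Dual K S.h ≃ₗ[K] Module.Dual K S.h) :=
  {w | ∃ α ∈ S.Φ, ∀ lam, w lam = lam - (lam (S.coroot α)) • α}

/-- The Weyl group `W`, generated by all reflections. -/
def weylGroup : Subgroup (Module.Dual K S.h ≃ₗ[K] Module.Dual K S.h) :=
  Subgroup.closure S.reflSet

/-- The integral Weyl group `W[λ]` of a weight. -/
def intWeyl (lam : Module.Dual K S.h) :
    Set (Module.Dual K S.h ≃ₗ[K] Module.Dual K S.h) :=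
  {w | w ∈ S.weylGroup ∧ S.dot w lam - lam ∈ S.zroots}

/-- The orbit `[[λ]] = W[λ] · λ`. -/
def orbit (lam : Module.Dual K S.h) : Set (Module.Dual K S.h) :=
  {μ | ∃ w ∈ S.intWeyl lam, μ = S.dot w lam}

/-- An integral weight. -/
def IsIntegral (lam : Module.Dual K S.h) : Prop :=
  ∀ w ∈ S.weylGroup, S.dot w lam - lam ∈ S.zroots

/-- A dominant weight. -/
def IsDominant (lam : Module.Dual K S.h) : Prop :=
  ∀ w ∈ S.intWeyl lam, S.wle (S.dot w lam) lam

/-- An antidominant weight. -/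
def IsAntidominant (lam : Module.Dual K S.h) : Prop :=
  ∀ w ∈ S.intWeyl lam, S.wle lam (S.dot w lam)

/-- A regular weight. -/
def IsRegular (lam : Module.Dual K S.h) : Prop :=
  ∀ w ∈ S.intWeyl lam, S.dot w lam = lam → w = 1

/-- A Verma flag with highest weights in a prescribed set. -/
def HasVermaFlagIn (A : Set (Module.Dual K S.h)) (M : Type) [AddCommGroup M]
    [Module (UEA K g) M] : Prop :=
  ∃ (n : ℕ) (F : Fin (n+1) →o Submodule (UEA K g) M), F 0 = ⊥ ∧ F (Fin.last n) = ⊤ ∧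
    ∀ i : Fin n, ∃ lam ∈ A,
      Nonempty ((subquot (F i.castSucc) (F i.succ)) ≃ₗ[UEA K g] S.Verma lam)

/-- A (finite) Verma flag. -/
def HasVermaFlag (M : Type) [AddCommGroup M] [Module (UEA K g) M] : Prop :=
  S.HasVermaFlagIn Set.univ M

end RootReductive
/-- The Lie algebra `gl_∞` of finitary infinite matrices: endomorphisms of `⊕_ℕ K`
with only finitely many non-zero matrix entries (equivalently, finitely many non-zero
columns). -/
def glInf : LieSubalgebra K (Module.End K (ℕ →₀ K)) where
  carrier := {f | {j : ℕ | f (Finsupp.single j 1) ≠ 0}.Finite}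
  add_mem' := by
    intro f f' hf hf'
    refine (hf.union hf').subset ?_
    intro j hj
    simp only [Set.mem_setOf_eq, LinearMap.add_apply] at hj
    by_contra hc
    simp only [Set.mem_union, Set.mem_setOf_eq, not_or, not_not] at hc
    rw [hc.1, hc.2, add_zero] at hj
    exact hj rfl
  zero_mem' := by simpa using Set.finite_empty
  smul_mem' := by
    intro c f hf
    refine hf.subset ?_
    intro j hj
    simp only [Set.mem_setOf_eq, LinearMap.smul_apply] at hj
    simp only [Set.mem_setOf_eq]
    intro h
    rw [h, smul_zero] at hj
    exact hj rfl
  lie_mem' := by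
    intro f f' hf hf'
    refine (hf.union hf').subset ?_
    intro j hj
    simp only [Set.mem_setOf_eq, LieRing.of_associative_ring_bracket,
      LinearMap.sub_apply, Module.End.mul_apply] at hj
    by_contra hc
    simp only [Set.mem_union, Set.mem_setOf_eq, not_or, not_not] at hc
    rw [hc.2, hc.1, map_zero, map_zero, sub_zero] at hj
    exact hj rfl

variable {K} {g}

open CategoryTheory

section

variable (K g)

/-- The trivial one-dimensional `U(g)`-module `k = L(0)`. -/
def TrivMod : Type := K

instance : AddCommGroup (TrivMod K) := inferInstanceAs (AddCommGroup K)

instance : Module K (TrivMod K) := inferInstanceAs (Module K K)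

instance : SMulCommClass K K (TrivMod K) := inferInstanceAs (SMulCommClass K K K)

noncomputable instance : Module (UEA K g) (TrivMod K) :=
  Module.compHom K (UniversalEnvelopingAlgebra.lift K (0 : g →ₗ⁅K⁆ K)).toRingHom

/-- Multiplication by a scalar `c : K` on the trivial module, as a `U(g)`-linear map. -/
def trivSmul (c : K) : TrivMod K →ₗ[UEA K g] TrivMod K where
  toFun m := c • m
  map_add' := smul_add c
  map_smul' u m := by
    change c • ((UniversalEnvelopingAlgebra.lift K (0 : g →ₗ⁅K⁆ K)) u • m) =
      (UniversalEnvelopingAlgebra.lift K (0 : g →ₗ⁅K⁆ K)) u • (c • m)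
    exact smul_comm _ _ _

end

/-- The category `O = O(g,b)`. -/
abbrev catO (S : RootReductive K g) : Type 1 :=
  CategoryTheory.ObjectProperty.FullSubcategory (fun M : ModuleCat (UEA K g) => S.InO M)

section Extensions

open Limits

universe w v

open DerivedCategory in
lemma exists_epi_comp_eq_zero {C : Type u} [Category.{v} C] [Abelian C] [HasExt.{w} C]
    {X Y : C} (ζ : Abelian.Ext X Y 1) :
    ∃ (P : C) (p : P ⟶ X), Epi p ∧ (Abelian.Ext.mk₀ p).comp ζ (zero_add 1) = 0 := by
  let := HasDerivedCategory.standard C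
  let F := HomologicalComplex.single C (ComplexShape.up ℤ) 0
  let K : CochainComplex C ℤ := F.obj X
  let L : CochainComplex C ℤ := F.obj Y
  let z : Q.obj K ⟶ (Q.obj L)⟦(1:ℤ)⟧ := ζ.hom
  let f : Q.obj K ⟶ Q.obj (L⟦(1:ℤ)⟧) := z ≫ (Q.commShiftIso (1:ℤ)).inv.app L
  obtain ⟨X', s, hs, g, hf⟩ := right_fac f
  let j : F.obj (X'.cycles 0) ⟶ X' :=
    HomologicalComplex.mkHomFromSingle (X'.iCycles 0) (by intro k _; simp)
  let p : X'.cycles 0 ⟶ X := HomologicalComplex.cyclesMap s 0 ≫ K.iCycles 0 ≫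
      (HomologicalComplex.singleObjXSelf (ComplexShape.up ℤ) 0 X).hom
  have hp : F.map p = j ≫ s := by
    refine HomologicalComplex.from_single_hom_ext ?_
    rw [HomologicalComplex.comp_f, HomologicalComplex.mkHomFromSingle_f,
      HomologicalComplex.single_map_f_self]
    simp [p]
  have hjg : j ≫ g = 0 := by
    refine HomologicalComplex.from_single_hom_ext ?_
    apply IsZero.eq_of_tgt
    exact HomologicalComplex.isZero_single_obj_X (ComplexShape.up ℤ) 0 Y (0 + 1) (by decide)
  refine ⟨X'.cycles 0, p, ?_, ?_⟩
  · have hq : QuasiIso s := by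
      rw [← isIso_Q_map_iff_quasiIso]; exact hs
    have e1 : Epi (HomologicalComplex.cyclesMap s 0) := by
      have : IsIso (K.homologyπ 0) := K.isIso_homologyπ (-1) 0 (by simp)
        (IsZero.eq_of_src (HomologicalComplex.isZero_single_obj_X _ _ _ _ (by decide)) _ _)
      have h := HomologicalComplex.homologyπ_naturality s 0
      have h' : HomologicalComplex.cyclesMap s 0 =
          X'.homologyπ 0 ≫ HomologicalComplex.homologyMap s 0 ≫ inv (K.homologyπ 0) := by
        rw [← Category.assoc, h, Category.assoc, IsIso.hom_inv_id, Category.comp_id]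
      rw [h']
      infer_instance
    have e2 : IsIso (K.iCycles 0) := K.isIso_iCycles 0 1 (by simp)
        (IsZero.eq_of_tgt (HomologicalComplex.isZero_single_obj_X _ _ _ _ (by decide)) _ _)
    have e3 : Epi (K.iCycles 0 ≫
      (HomologicalComplex.singleObjXSelf (ComplexShape.up ℤ) 0 X).hom) := epi_comp _ _
    exact epi_comp _ _
  · have h1 : z = f ≫ (Q.commShiftIso (1:ℤ)).hom.app L := by
      dsimp only [f]
      rw [Category.assoc, Iso.inv_hom_id_app]
      exact (Category.comp_id _).symm
    have h2 : Q.map (F.map p) ≫ z = 0 := by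
      rw [h1, hf, hp, Q.map_comp, Category.assoc, Category.assoc, IsIso.hom_inv_id_assoc,
        ← Q.map_comp_assoc, hjg]
      simp
    ext
    rw [Abelian.Ext.comp_hom, Abelian.Ext.mk₀_hom, ShiftedHom.mk₀_comp, Abelian.Ext.zero_hom]
    exact h2

lemma exists_lift_of_comp_eq_zero {C : Type u} [Category.{v} C] [Abelian C] [HasExt.{w} C]
    {T A Q E B T' : C} {t : T ⟶ A} {π : A ⟶ Q} {f : Q ⟶ E} {q : E ⟶ B}
    {w₁ : t ≫ π = 0} {w₂ : f ≫ q = 0}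
    (h₁ : (ShortComplex.mk t π w₁).ShortExact) (h₂ : (ShortComplex.mk f q w₂).ShortExact)
    (ι : T' ⟶ B)
    (h : (Abelian.Ext.mk₀ ι).comp (h₂.extClass.comp h₁.extClass (rfl : 1 + 1 = 2))
      (zero_add 2) = 0) :
    ∃ (N P : C) (i : N ⟶ P) (p : P ⟶ T') (w : i ≫ p = 0) (_ : (ShortComplex.mk i p w).ShortExact)
      (g : N ⟶ A) (s : P ⟶ E), s ≫ q = p ≫ ι ∧ i ≫ s = g ≫ π ≫ f := by
  have h' : ((Abelian.Ext.mk₀ ι).comp h₂.extClass (zero_add 1)).comp h₁.extClass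
      (rfl : 1 + 1 = 2) = 0 := by
    rw [Abelian.Ext.comp_assoc _ _ _ (zero_add 1) (rfl : 1 + 1 = 2) rfl]
    exact h
  obtain ⟨ζ, hζ⟩ := Abelian.Ext.covariant_sequence_exact₃ _ h₁ _ rfl h'
  obtain ⟨P, p, _, hp⟩ := exists_epi_comp_eq_zero ζ
  have h₃ : (ShortComplex.mk _ _ (kernel.condition p)).ShortExact :=
    { exact := ShortComplex.exact_kernel p }
  obtain ⟨g₀, hg₀⟩ := Abelian.Ext.contravariant_sequence_exact₃ h₃ _ ζ hp (add_zero 1)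
  obtain ⟨g, rfl⟩ := (Abelian.Ext.mk₀_bijective _ _).2 g₀
  have hs : (Abelian.Ext.mk₀ (p ≫ ι)).comp h₂.extClass (zero_add 1) = 0 := by
    rw [← Abelian.Ext.mk₀_comp_mk₀_assoc, ← hζ, ← Abelian.Ext.comp_assoc_of_third_deg_zero, hp,
      Abelian.Ext.zero_comp]
  obtain ⟨s₀, hs₀⟩ := Abelian.Ext.covariant_sequence_exact₃ _ h₂ _ (zero_add 1) hs
  obtain ⟨s, rfl⟩ := (Abelian.Ext.mk₀_bijective _ _).2 s₀
  have hsq : s ≫ q = p ≫ ι := by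
    rw [Abelian.Ext.mk₀_comp_mk₀] at hs₀
    exact (Abelian.Ext.mk₀_bijective _ _).1 hs₀
  let i := kernel.ι p
  have hip : i ≫ p = 0 := kernel.condition p
  have := h₂.mono_f
  let u := h₂.exact.lift (i ≫ s) (by
    change (i ≫ s) ≫ q = 0
    rw [Category.assoc, hsq, reassoc_of% hip, zero_comp])
  have hu : u ≫ f = i ≫ s := h₂.exact.lift_f _ _
  have nat := ShortComplex.ShortExact.extClass_naturality h₃ h₂
    { τ₁ := u, τ₂ := s, τ₃ := ι, comm₁₂ := hu, comm₂₃ := hsq }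
  have hd : h₃.extClass.comp (Abelian.Ext.mk₀ (u - g ≫ π)) (add_zero 1) = 0 := by
    change (h₃.extClass).comp (Abelian.Ext.mk₀ u) (add_zero 1) =
      (Abelian.Ext.mk₀ ι).comp h₂.extClass (zero_add 1) at nat
    change (Abelian.Ext.comp _ _ _) = (Abelian.Ext.comp _ _ _) at hζ
    rw [sub_eq_add_neg, Abelian.Ext.mk₀_add, Abelian.Ext.mk₀_neg, Abelian.Ext.comp_add,
      Abelian.Ext.comp_neg, nat, ← Abelian.Ext.mk₀_comp_mk₀,
      ← Abelian.Ext.comp_assoc_of_second_deg_zero, hg₀, ← hζ, add_neg_cancel]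
  obtain ⟨r₀, hr₀⟩ := Abelian.Ext.contravariant_sequence_exact₁ h₃ _ _ (add_zero 1) hd
  obtain ⟨r, rfl⟩ := (Abelian.Ext.mk₀_bijective _ _).2 r₀
  have hr : i ≫ r = u - g ≫ π := by
    rw [Abelian.Ext.mk₀_comp_mk₀] at hr₀
    exact (Abelian.Ext.mk₀_bijective _ _).1 hr₀
  refine ⟨_, P, i, p, hip, h₃, g, s - r ≫ f, ?_, ?_⟩
  · rw [Preadditive.sub_comp, Category.assoc, w₂, comp_zero, sub_zero, hsq]
  · rw [Preadditive.comp_sub, ← hu, reassoc_of% hr, Preadditive.sub_comp, Category.assoc]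
    abel

end Extensions

lemma lie_mem_wtSpace {h : LieSubalgebra K g} {M : Type} [AddCommGroup M] [Module K M]
    [LieRingModule g M] [LieModule K g M] {α ν : Module.Dual K h} {x : g} {m : M}
    (hx : x ∈ rootSp K g h α) (hm : m ∈ wtSpace K g h M ν) :
    ⁅x, m⁆ ∈ wtSpace K g h M (α + ν) := fun H => by
  rw [leibniz_lie, hx H, hm H, smul_lie, lie_smul, LinearMap.add_apply, add_smul]

lemma iSupIndep_wtSpace (h : LieSubalgebra K g) (M : Type) [AddCommGroup M] [Module K M]
    [LieRingModule g M] [LieModule K g M] : iSupIndep (wtSpace K g h M) := by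
  classical
  rw [iSupIndep_iff_finsetSum_eq_zero_imp_eq_zero]
  intro s
  induction s using Finset.induction_on with
  | empty => simp
  | insert a s ha ih =>
    intro v hv h0
    have hs : ∀ i ∈ s, v i = 0 := by
      intro i hi
      obtain ⟨H, hH⟩ : ∃ H, i H ≠ a H := by
        by_contra! hc
        exact ha (LinearMap.ext hc ▸ hi)
      have key : ∑ j ∈ s, (j H - a H) • v j = 0 := by
        have h1 : ∑ j ∈ insert a s, (j H - a H) • v j = 0 := by
          have h2 : ∑ j ∈ insert a s, j H • v j = 0 := by
            rw [← Finset.sum_congr rfl (fun j hj => hv j hj H), ← lie_sum, h0, lie_zero]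
          simp_rw [sub_smul]
          rw [Finset.sum_sub_distrib, h2, ← Finset.smul_sum, h0, smul_zero, sub_zero]
        rwa [Finset.sum_insert ha, sub_self, zero_smul, zero_add] at h1
      have := ih (fun j => (j H - a H) • v j)
        (fun j hj => Submodule.smul_mem _ _ (hv j (Finset.mem_insert_of_mem hj))) key i hi
      exact (smul_eq_zero.1 this).resolve_left (sub_ne_zero.2 hH)
    intro i hi
    rcases Finset.mem_insert.1 hi with rfl | hi
    · rwa [Finset.sum_insert ha, Finset.sum_eq_zero hs, add_zero] at h0
    · exact hs i hi

/-- Homogeneous components of an action are determined by the weights: if `f = ∑ F α` with `F α`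
of weight `α` and `f` maps `u` of weight `ν` into weight `μ`, then only `F (μ - ν)` sees `u`. -/
lemma component_lie_eq {h : LieSubalgebra K g} {M : Type} [AddCommGroup M] [Module K M]
    [LieRingModule g M] [LieModule K g M] {F : Module.Dual K h →₀ g}
    (hF : ∀ α, F α ∈ rootSp K g h α) {μ ν : Module.Dual K h} {u : M}
    (hu : u ∈ wtSpace K g h M ν) (hf : ⁅F.sum fun _ x => x, u⁆ ∈ wtSpace K g h M μ)
    (κ : Module.Dual K h) :
    ⁅F (κ - ν), u⁆ = open scoped Classical in if κ = μ then ⁅F.sum fun _ x => x, u⁆ else 0 := by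
  classical
  set f := F.sum fun _ x => x with hfdef
  refine (iSupIndep_iff_finsetSum_eq_imp_eq _).1 (iSupIndep_wtSpace h M)
    (insert κ (insert μ (F.support.image (· + ν)))) (fun κ => ⁅F (κ - ν), u⁆)
    (fun κ => if κ = μ then ⁅f, u⁆ else 0) ?_ ?_ κ (Finset.mem_insert_self _ _)
  · intro κ _
    refine ⟨by simpa using lie_mem_wtSpace (hF (κ - ν)) hu, ?_⟩
    split_ifs with hκ
    · exact hκ ▸ hf
    · exact zero_mem _
  · rw [Finset.sum_ite_eq' _ μ, if_pos (by simp), hfdef, Finsupp.sum, sum_lie]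
    rw [← Finset.sum_subset ((Finset.subset_insert μ _).trans (Finset.subset_insert κ _)),
      Finset.sum_image]
    · simp
    · intro a _ b _ hab
      exact add_right_cancel hab
    · intro κ _ hκ
      have : F (κ - ν) = 0 := by
        by_contra hne
        exact hκ (Finset.mem_image.2 ⟨κ - ν, Finsupp.mem_support_iff.2 hne, sub_add_cancel _ _⟩)
      rw [this, zero_lie]

namespace RootReductive

lemma lie_h_eq_zero (S : RootReductive K g) {x y : g} (hx : x ∈ S.h) (hy : y ∈ S.h) :
    ⁅x, y⁆ = 0 := by
  have h := S.τ_anti x y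
  rw [S.τ_h _ (S.h.lie_mem hx hy), S.τ_h _ hx, S.τ_h _ hy, ← lie_skew x y] at h
  have h2 : (2 : K) • ⁅x, y⁆ = 0 := by
    rw [two_smul]
    nth_rewrite 1 [← lie_skew x y]
    rw [h, ← lie_skew x y, add_neg_cancel]
  exact (smul_eq_zero.1 h2).resolve_left two_ne_zero

lemma h_le_rootSp_zero (S : RootReductive K g) : S.h.toSubmodule ≤ rootSp K g S.h 0 :=
  fun x hx H => by simpa using S.lie_h_eq_zero H.2 hx

lemma exists_components (S : RootReductive K g) (f : g) :
    ∃ F : Module.Dual K S.h →₀ g, (∀ α, F α ∈ rootSp K g S.h α) ∧ F 0 ∈ S.h ∧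
      (F.sum fun _ x => x) = f := by
  classical
  let W : Module.Dual K S.h → Submodule K g :=
    fun α => if α = 0 then S.h.toSubmodule else rootSp K g S.h α
  have hW : iSup W = ⊤ := by
    rw [eq_top_iff, ← S.rootdec]
    refine sup_le ?_ (iSup₂_le fun α hα => ?_)
    · exact le_trans (by simp [W]) (le_iSup W 0)
    · have : α ≠ 0 := ((S.root_iff α).1 hα).1
      exact le_trans (by simp [W, this]) (le_iSup W α)
  obtain ⟨F, hF, hf⟩ := (Submodule.mem_iSup_iff_exists_finsupp W f).1 (hW ▸ Submodule.mem_top)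
  refine ⟨F, fun α => ?_, by simpa [W] using hF 0, hf⟩
  by_cases hα : α = 0
  · subst hα
    exact S.h_le_rootSp_zero (by simpa [W] using hF 0)
  · simpa [W, hα] using hF α

end RootReductive

section FinitaryAction

variable {V : Type} [AddCommGroup V] [Module K V] [LieRingModule g V] [LieModule K g V]

variable (K g V) in
/-- `g` acts on `V` as the Lie algebra of finitary operators `V ⊗ D`, for a space `D` of
functionals separating the points of `V`. -/
structure IsFinitaryAction (D : Submodule K (Module.Dual K V)) : Prop where
  faithful : ∀ x : g, (∀ v : V, ⁅x, v⁆ = 0) → x = 0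
  exists_rankOne : ∀ v : V, ∀ ψ ∈ D, ∃ x : g, ∀ u : V, ⁅x, u⁆ = ψ u • v
  exists_dual : ∀ u : V, u ≠ 0 → ∃ ψ ∈ D, ψ u = 1
  exists_sum : ∀ x : g, ∃ (n : ℕ) (v : Fin n → V) (ψ : Fin n → Module.Dual K V),
    (∀ i, ψ i ∈ D) ∧ ∀ u, ⁅x, u⁆ = ∑ i, ψ i u • v i

namespace IsFinitaryAction

variable {D : Submodule K (Module.Dual K V)} (hV : IsFinitaryAction K g V D)
include hV

lemma ext {x y : g} (h : ∀ v : V, ⁅x, v⁆ = ⁅y, v⁆) : x = y :=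
  sub_eq_zero.1 (hV.faithful _ fun v => by rw [sub_lie, h v, sub_self])

lemma dual_mem {x : g} {ψ : Module.Dual K V} {v : V} (hv : v ≠ 0)
    (h : ∀ u : V, ⁅x, u⁆ = ψ u • v) : ψ ∈ D := by
  obtain ⟨χ, -, hχ⟩ := hV.exists_dual v hv
  obtain ⟨n, w, φ, hφ, hx⟩ := hV.exists_sum x
  have : ψ = ∑ i, χ (w i) • φ i := by
    ext u
    have := congrArg χ ((h u).symm.trans (hx u))
    simpa [hχ, mul_comm] using this
  rw [this]
  exact Submodule.sum_mem _ fun i _ => Submodule.smul_mem _ _ (hφ i)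

lemma finiteDimensional_range (x : g) :
    FiniteDimensional K (LinearMap.range (LieModule.toEnd K g V x)) := by
  obtain ⟨n, w, φ, hφ, hx⟩ := hV.exists_sum x
  have := FiniteDimensional.span_of_finite K (Set.finite_range w)
  refine Submodule.finiteDimensional_of_le (S₂ := Submodule.span K (Set.range w)) ?_
  rintro _ ⟨v, rfl⟩
  rw [LieModule.toEnd_apply_apply, hx]
  exact Submodule.sum_mem _ fun i _ =>
    Submodule.smul_mem _ _ (Submodule.subset_span ⟨i, rfl⟩)

variable (S : RootReductive K g)

lemma exists_weight_vector [Nontrivial V] :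
    ∃ (ν : Module.Dual K S.h) (u : V), u ∈ wtSpace K g S.h V ν ∧ u ≠ 0 := by
  obtain ⟨α, f, hf, hf0⟩ : ∃ (α : Module.Dual K S.h) (f : g), f ∈ rootSp K g S.h α ∧ f ≠ 0 := by
    by_contra! hc
    obtain ⟨u, hu⟩ := exists_ne (0 : V)
    obtain ⟨ψ, hψ, hψu⟩ := hV.exists_dual u hu
    obtain ⟨f, hf⟩ := hV.exists_rankOne u ψ hψ
    obtain ⟨F, hF, -, hs⟩ := S.exists_components f
    have h0 : f = 0 := by
      rw [← hs]
      exact Finset.sum_eq_zero fun α _ => hc α _ (hF α)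
    have h1 := hf u
    rw [h0, zero_lie, hψu, one_smul] at h1
    exact hu h1.symm
  let R : LieSubmodule K S.h V :=
    { LinearMap.range (LieModule.toEnd K g V f) with
      lie_mem := by
        rintro H _ ⟨v, rfl⟩
        refine ⟨α H • v + ⁅(H : g), v⁆, ?_⟩
        have := leibniz_lie (H : g) f v
        rw [hf H, smul_lie] at this
        rw [map_add, map_smul]
        exact this.symm }
  have : FiniteDimensional K R := hV.finiteDimensional_range f
  have : Nontrivial R := by
    obtain ⟨v, hv⟩ : ∃ v : V, ⁅f, v⁆ ≠ 0 := by
      by_contra! hc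
      exact hf0 (hV.faithful _ hc)
    exact ⟨⟨⟨⁅f, v⁆, v, rfl⟩, 0, fun h => hv (congrArg Subtype.val h)⟩⟩
  have : IsLieAbelian S.h :=
    ⟨fun x y => Subtype.ext (S.lie_h_eq_zero x.2 y.2)⟩
  obtain ⟨χ, hχ⟩ := LieModule.exists_nontrivial_weightSpace_of_isSolvable K S.h R
  obtain ⟨⟨m, hm⟩, hm0⟩ := exists_ne (0 : LieModule.weightSpace R χ)
  rw [LieModule.mem_weightSpace] at hm
  refine ⟨χ, m, fun H => congrArg Subtype.val (hm H), fun h => hm0 ?_⟩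
  exact Subtype.ext (Subtype.ext h)

lemma iSup_wtSpace_eq_top : ⨆ μ, wtSpace K g S.h V μ = ⊤ := by
  rcases subsingleton_or_nontrivial V with _ | _
  · exact Subsingleton.elim _ _
  obtain ⟨ν, u, hu, hu0⟩ := hV.exists_weight_vector S
  obtain ⟨ψ, hψ, hψu⟩ := hV.exists_dual u hu0
  rw [eq_top_iff]
  intro v _
  obtain ⟨f, hf⟩ := hV.exists_rankOne v ψ hψ
  obtain ⟨F, hF, -, hs⟩ := S.exists_components f
  have : v = ∑ α ∈ F.support, ⁅F α, u⁆ := by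
    rw [← sum_lie]
    change v = ⁅F.sum fun _ x => x, u⁆
    rw [hs, hf, hψu, one_smul]
  rw [this]
  exact Submodule.sum_mem _ fun α _ => Submodule.mem_iSup_of_mem _ (lie_mem_wtSpace (hF α) hu)

/-- Weight spaces of the natural module are one-dimensional, and the projections onto them lie
in the Cartan subalgebra. -/
lemma exists_projection {μ : Module.Dual K S.h} {v : V}
    (hv : v ∈ wtSpace K g S.h V μ) (hv0 : v ≠ 0) :
    ∃ p : S.h, μ p = 1 ∧ (∀ u ∈ wtSpace K g S.h V μ, ∃ c : K, u = c • v) ∧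
      ∀ ν, ν ≠ μ → ∀ u ∈ wtSpace K g S.h V ν, ⁅(p : g), u⁆ = 0 := by
  obtain ⟨ψ, hψ, hψv⟩ := hV.exists_dual v hv0
  obtain ⟨f, hf⟩ := hV.exists_rankOne v ψ hψ
  obtain ⟨F, hF, hF0, hs⟩ := S.exists_components f
  have key : ∀ κ ν, ∀ u ∈ wtSpace K g S.h V ν,
      ⁅F (κ - ν), u⁆ = open scoped Classical in if κ = μ then ψ u • v else 0 := by
    intro κ ν u hu
    rw [component_lie_eq hF (μ := μ) hu (by rw [hs, hf]; exact Submodule.smul_mem _ _ hv), hs, hf]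
  have h1 : ∀ u ∈ wtSpace K g S.h V μ, μ ⟨F 0, hF0⟩ • u = ψ u • v := by
    intro u hu
    have := key μ μ u hu
    rw [sub_self, if_pos rfl] at this
    rw [← this]
    exact (hu ⟨F 0, hF0⟩).symm
  have hμ : μ ⟨F 0, hF0⟩ = 1 := by
    have := h1 v hv
    rw [hψv] at this
    exact smul_left_injective K hv0 this
  refine ⟨⟨F 0, hF0⟩, hμ, fun u hu => ⟨ψ u, ?_⟩, fun ν hν u hu => ?_⟩
  · have := h1 u hu
    rwa [hμ, one_smul] at this
  · simpa [hν] using key ν ν u hu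

end IsFinitaryAction

end FinitaryAction

/-- A basis of `V` of weight vectors with distinct weights, together with the projections onto
its members, which lie in the Cartan subalgebra. -/
structure WeightBasis (S : RootReductive K g) (V : Type) [AddCommGroup V] [Module K V]
    [LieRingModule g V] [LieModule K g V] (X : Type) where
  basis : Module.Basis X K V
  wt : X → Module.Dual K S.h
  wt_injective : Function.Injective wt
  lie_basis : ∀ a, ∀ H : S.h, ⁅(H : g), basis a⁆ = wt a H • basis a
  proj : X → S.h
  lie_proj : ∀ a u, ⁅(proj a : g), u⁆ = basis.coord a u • basis a

lemma IsFinitaryAction.exists_weightBasis {V : Type} [AddCommGroup V] [Module K V]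
    [LieRingModule g V] [LieModule K g V] {D : Submodule K (Module.Dual K V)}
    (hV : IsFinitaryAction K g V D) (S : RootReductive K g) :
    ∃ X : Type, Nonempty (WeightBasis S V X) := by
  let X : Type := {μ : Module.Dual K S.h // wtSpace K g S.h V μ ≠ ⊥}
  have hX : ∀ a : X, ∃ v ∈ wtSpace K g S.h V a.1, v ≠ 0 := fun a =>
    (Submodule.ne_bot_iff _).1 a.2
  choose v hv hv0 using hX
  choose p hp1 hp2 hp3 using fun a : X => hV.exists_projection S (hv a) (hv0 a)
  have hli : LinearIndependent K v :=
    ((iSupIndep_wtSpace S.h V).comp Subtype.val_injective).linearIndependent _ hv hv0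
  have hsp : ⊤ ≤ Submodule.span K (Set.range v) := by
    rw [← hV.iSup_wtSpace_eq_top S]
    refine iSup_le fun μ u hu => ?_
    by_cases h0 : wtSpace K g S.h V μ = ⊥
    · rw [h0, Submodule.mem_bot] at hu
      rw [hu]; exact zero_mem _
    · obtain ⟨c, rfl⟩ := hp2 ⟨μ, h0⟩ u hu
      exact Submodule.smul_mem _ _ (Submodule.subset_span ⟨_, rfl⟩)
  refine ⟨X, ⟨Module.Basis.mk hli hsp, Subtype.val, Subtype.val_injective, fun a H => ?_, p,
    fun a u => ?_⟩⟩
  · rw [Module.Basis.mk_apply]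
    exact hv a H
  · have : LieModule.toEnd K g V (p a) =
        ((Module.Basis.mk hli hsp).coord a).smulRight (Module.Basis.mk hli hsp a) := by
      classical
      refine (Module.Basis.mk hli hsp).ext fun b => ?_
      rw [LinearMap.smulRight_apply, Module.Basis.coord_apply, Module.Basis.repr_self,
        LieModule.toEnd_apply_apply, Finsupp.single_apply]
      simp only [Module.Basis.mk_apply]
      split_ifs with hb
      · subst hb
        rw [hv b (p b), hp1]
      · rw [hp3 a b.1 (fun h => hb (Subtype.ext h)) _ (hv b), zero_smul]
    exact LinearMap.congr_fun this u

/-- A basis of `g` of matrix units adapted to the triangular decomposition. -/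
structure MatrixUnits (S : RootReductive K g) (X : Type) [LinearOrder X] where
  E : Module.Basis (X × X) K g
  lie_E : ∀ a b c d, ⁅E (a, b), E (c, d)⁆ =
    (if b = c then E (a, d) else 0) - (if d = a then E (c, b) else 0)
  diag_mem : ∀ a, E (a, a) ∈ S.h
  h_le : S.h.toSubmodule ≤ Submodule.span K (Set.range fun a => E (a, a))
  b_le : S.b.toSubmodule ≤ Submodule.span K (E '' {p | p.1 ≤ p.2})
  finite_Icc : ∀ a b : X, (Set.Icc a b).Finite

namespace WeightBasis

variable {S : RootReductive K g} {V : Type} [AddCommGroup V] [Module K V]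
  [LieRingModule g V] [LieModule K g V] {X : Type} (w : WeightBasis S V X)
  {D : Submodule K (Module.Dual K V)} (hV : IsFinitaryAction K g V D)

lemma wt_proj (a b : X) :
    w.wt a (w.proj b) = open scoped Classical in if a = b then 1 else 0 := by
  classical
  have h := w.lie_proj b (w.basis a)
  rw [w.lie_basis a (w.proj b), Module.Basis.coord_apply, Module.Basis.repr_self,
    Finsupp.single_apply] at h
  split_ifs at h ⊢ with hab
  · subst hab
    exact smul_left_injective K (w.basis.ne_zero a) h
  · exact (smul_eq_zero.1 (h.trans (zero_smul _ _))).resolve_right (w.basis.ne_zero a)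

lemma linearIndependent_wt : LinearIndependent K w.wt := by
  classical
  rw [linearIndependent_iff']
  intro s c h i hi
  have := LinearMap.congr_fun h (w.proj i)
  simpa [w.wt_proj, hi] using this

lemma basis_mem (a : X) : w.basis a ∈ wtSpace K g S.h V (w.wt a) := w.lie_basis a

lemma coord_lie (a : X) (H : S.h) (u : V) :
    w.basis.coord a ⁅(H : g), u⁆ = w.wt a H * w.basis.coord a u := by
  classical
  have : w.basis.coord a ∘ₗ LieModule.toEnd K g V H = w.wt a H • w.basis.coord a := by
    refine w.basis.ext fun b => ?_
    simp only [LinearMap.comp_apply, LieModule.toEnd_apply_apply, w.lie_basis,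
      LinearMap.smul_apply, map_smul, Module.Basis.coord_apply, Module.Basis.repr_self,
      Finsupp.single_apply, smul_eq_mul]
    split_ifs with hab
    · rw [hab]
    · simp
  exact LinearMap.congr_fun this u

/-- A weight space of `V` only sees the coordinate with the same weight. -/
lemma wt_eq_of_coord_ne_zero {κ : Module.Dual K S.h} {u : V} (hu : u ∈ wtSpace K g S.h V κ)
    {a : X} (ha : w.basis.coord a u ≠ 0) : w.wt a = κ := by
  ext H
  have := w.coord_lie a H u
  rw [hu H, map_smul, smul_eq_mul] at this
  exact (mul_right_cancel₀ ha this).symm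

include hV

lemma coord_mem (a : X) : w.basis.coord a ∈ D :=
  hV.dual_mem (w.basis.ne_zero a) (w.lie_proj a)

lemma exists_unit (a b : X) : ∃ x : g, ∀ u : V, ⁅x, u⁆ = w.basis.coord b u • w.basis a :=
  hV.exists_rankOne _ _ (w.coord_mem hV b)

/-- The matrix unit sending the basis vector `b` to `a`. -/
def unit (a b : X) : g := (w.exists_unit hV a b).choose

lemma unit_lie (a b : X) (u : V) : ⁅w.unit hV a b, u⁆ = w.basis.coord b u • w.basis a :=
  (w.exists_unit hV a b).choose_spec u

lemma unit_diag (a : X) : w.unit hV a a = w.proj a :=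
  hV.ext fun v => by rw [unit_lie, w.lie_proj]

lemma unit_mem_rootSp (a b : X) : w.unit hV a b ∈ rootSp K g S.h (w.wt a - w.wt b) := fun H => by
  refine hV.ext fun v => ?_
  rw [lie_lie, unit_lie, lie_smul, unit_lie, smul_lie, unit_lie, w.lie_basis, w.coord_lie,
    LinearMap.sub_apply]
  module

lemma lie_unit (a b c d : X) : ⁅w.unit hV a b, w.unit hV c d⁆ = open scoped Classical in
    (if b = c then w.unit hV a d else 0) - (if d = a then w.unit hV c b else 0) := by
  classical
  refine hV.ext fun v => ?_
  rw [lie_lie, sub_lie]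
  simp only [unit_lie, lie_smul, Module.Basis.coord_apply, Module.Basis.repr_self,
    Finsupp.single_apply, eq_comm (a := b), eq_comm (a := d)]
  split_ifs <;> simp [unit_lie]

lemma finite_lie_basis (f : g) : {a : X | ⁅f, w.basis a⁆ ≠ 0}.Finite := by
  have main : ∀ (v : V), ∀ ψ ∈ D, {a : X | ψ (w.basis a) • v ≠ 0}.Finite := by
    intro v ψ hψ
    have hv : v ∈ Submodule.span K (Set.range w.basis) := w.basis.span_eq ▸ Submodule.mem_top
    induction hv using Submodule.span_induction with
    | zero => simp
    | add v v' _ _ h h' =>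
      refine (h.union h').subset fun a ha => ?_
      by_contra hc
      simp only [Set.mem_union, Set.mem_ofPred_eq, not_or, not_not] at hc
      exact ha (by rw [smul_add, hc.1, hc.2, add_zero])
    | smul c v _ h =>
      refine h.subset fun a ha h0 => ha ?_
      rw [smul_comm, h0, smul_zero]
    | mem _ hb =>
      obtain ⟨b, rfl⟩ := hb
      obtain ⟨x, hx⟩ := hV.exists_rankOne (w.basis b) ψ hψ
      obtain ⟨F, hF, -, hs⟩ := S.exists_components x
      have hinj : Function.Injective fun a : X => w.wt b - w.wt a := fun a a' h =>
        w.wt_injective (sub_right_injective h)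
      refine (F.support.finite_toSet.preimage hinj.injOn).subset fun a ha => ?_
      have hk := component_lie_eq hF (μ := w.wt b) (w.basis_mem a)
        (by rw [hs, hx]; exact Submodule.smul_mem _ _ (w.basis_mem b)) (w.wt b)
      rw [if_pos rfl, hs, hx] at hk
      simp only [Set.mem_preimage, Finset.mem_coe, Finsupp.mem_support_iff]
      intro h0
      rw [h0, zero_lie] at hk
      exact ha hk.symm
  obtain ⟨n, v, ψ, hψ, hf⟩ := hV.exists_sum f
  refine (Set.finite_iUnion fun i => main (v i) (ψ i) (hψ i)).subset fun a ha => ?_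
  by_contra hc
  simp only [Set.mem_iUnion, Set.mem_ofPred_eq, not_exists, not_not] at hc
  exact ha (by rw [hf]; exact Finset.sum_eq_zero fun i _ => hc i)

/-- The basis of matrix units. -/
lemma exists_unitBasis : ∃ E : Module.Basis (X × X) K g,
    (∀ p, E p = w.unit hV p.1 p.2) ∧
    ∀ f a b, E.repr f (a, b) = w.basis.coord a ⁅f, w.basis b⁆ := by
  classical
  let E : Module.Basis (X × X) K g := Module.Basis.mk (v := fun p => w.unit hV p.1 p.2) ?_ ?_
  · have hE : ∀ p, E p = w.unit hV p.1 p.2 := fun p => by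
      rw [Module.Basis.mk_apply]
    refine ⟨E, hE, fun f a b => ?_⟩
    have : (Finsupp.lapply (a, b) ∘ₗ E.repr.toLinearMap : g →ₗ[K] K) =
        w.basis.coord a ∘ₗ LinearMap.applyₗ (w.basis b) ∘ₗ
          (LieModule.toEnd K g V : g →ₗ[K] Module.End K V) := by
      refine E.ext fun p => ?_
      change E.repr (E p) (a, b) = w.basis.coord a ⁅E p, w.basis b⁆
      rw [E.repr_self, hE, unit_lie, map_smul]
      simp only [Module.Basis.coord_apply, Module.Basis.repr_self, Finsupp.single_apply,
        Prod.ext_iff, smul_eq_mul]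
      split_ifs <;> simp_all
    exact LinearMap.congr_fun this f
  · rw [linearIndependent_iff']
    intro s c h p hp
    have h1 := congrArg (fun x : g => w.basis.coord p.1 ⁅x, w.basis p.2⁆) h
    simp only [sum_lie, smul_lie, unit_lie, map_sum, map_smul, zero_lie, map_zero,
      Module.Basis.coord_apply, Module.Basis.repr_self, Finsupp.single_apply, smul_eq_mul] at h1
    rw [Finset.sum_eq_single p] at h1
    · simpa using h1
    · intro q _ hq
      by_cases h2 : p.2 = q.2
      · have : q.1 ≠ p.1 := fun h => hq (Prod.ext h h2.symm)
        simp [this]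
      · simp [h2]
    · exact fun h => absurd hp h
  · intro f _
    have hfin := w.finite_lie_basis hV f
    have : f = ∑ b ∈ hfin.toFinset, (w.basis.repr ⁅f, w.basis b⁆).sum
        fun a c => c • w.unit hV a b := by
      have hlin : LieModule.toEnd K g V f = LieModule.toEnd K g V
          (∑ b ∈ hfin.toFinset, (w.basis.repr ⁅f, w.basis b⁆).sum
            fun a c => c • w.unit hV a b) := by
        refine w.basis.ext fun b => ?_
        simp only [LieModule.toEnd_apply_apply, sum_lie, Finsupp.sum, smul_lie, unit_lie,
          Module.Basis.coord_apply, Module.Basis.repr_self, Finsupp.single_apply]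
        by_cases hb : ⁅f, w.basis b⁆ = 0
        · rw [hb]
          refine (Finset.sum_eq_zero fun c hc => ?_).symm
          refine Finset.sum_eq_zero fun a _ => ?_
          have : b ≠ c := by
            rintro rfl
            exact (hfin.mem_toFinset.1 hc) hb
          simp [this]
        · rw [Finset.sum_eq_single b]
          · simpa [Finsupp.linearCombination_apply, Finsupp.sum] using
              (w.basis.linearCombination_repr ⁅f, w.basis b⁆).symm
          · intro c _ hc
            exact Finset.sum_eq_zero fun a _ => by simp [hc.symm]
          · intro h
            exact absurd (hfin.mem_toFinset.2 hb) h
      exact hV.ext fun v => LinearMap.congr_fun hlin v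
    rw [this]
    refine Submodule.sum_mem _ fun b _ => Submodule.sum_mem _ fun a _ => ?_
    exact Submodule.smul_mem _ _ (Submodule.subset_span ⟨(a, b), rfl⟩)

end WeightBasis

namespace WeightBasis

variable {S : RootReductive K g} {V : Type} [AddCommGroup V] [Module K V]
  [LieRingModule g V] [LieModule K g V] {X : Type} (w : WeightBasis S V X)
  {D : Submodule K (Module.Dual K V)} (hV : IsFinitaryAction K g V D)

/-- The order on the weights of `V` defined by the positive roots. -/
def rel (a b : X) : Prop := w.wt a - w.wt b ∈ S.Φp

include hV in
lemma sub_mem_Φ {a b : X} (h : a ≠ b) : w.wt a - w.wt b ∈ S.Φ := by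
  refine (S.root_iff _).2 ⟨sub_ne_zero.2 fun h' => h (w.wt_injective h'), ?_⟩
  refine (Submodule.ne_bot_iff _).2 ⟨_, w.unit_mem_rootSp hV a b, fun h0 => ?_⟩
  have := w.unit_lie hV a b (w.basis b)
  rw [h0, zero_lie, Module.Basis.coord_apply, Module.Basis.repr_self, Finsupp.single_eq_same,
    one_smul] at this
  exact w.basis.ne_zero a this.symm

lemma not_rel_of_rel {a b : X} (h : w.rel a b) : ¬ w.rel b a := fun h' =>
  Set.disjoint_left.1 S.pos_disjoint h (by simpa [rel] using h')

include hV in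
lemma isStrictTotalOrder_rel : IsStrictTotalOrder X w.rel where
  irrefl a h := w.not_rel_of_rel h h
  trans a b c hab hbc := by
    have hac : a ≠ c := by
      rintro rfl
      exact w.not_rel_of_rel hab hbc
    have := S.pos_add _ hab _ hbc
    rw [sub_add_sub_cancel] at this
    exact this (w.sub_mem_Φ hV hac)
  trichotomous a b hab hba := by
    by_contra hne
    have := w.sub_mem_Φ hV hne
    rw [S.pos_union] at this
    rcases this with h | h
    · exact hab h
    · exact hba (by simpa [rel] using h)

include hV in
lemma exists_rel_of_mem_Φp {α : Module.Dual K S.h} (hα : α ∈ S.Φp) :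
    ∃ a b, w.rel a b ∧ w.wt a - w.wt b = α := by
  obtain ⟨x, hx, hx0⟩ := (Submodule.ne_bot_iff _).1 ((S.root_iff α).1 (S.pos_subset hα)).2
  obtain ⟨b, hb⟩ : ∃ b, ⁅x, w.basis b⁆ ≠ 0 := by
    by_contra! hc
    have : LieModule.toEnd K g V x = 0 := w.basis.ext fun b => hc b
    exact hx0 (hV.faithful x fun v => LinearMap.congr_fun this v)
  obtain ⟨a, ha⟩ : ∃ a, w.basis.coord a ⁅x, w.basis b⁆ ≠ 0 := by
    by_contra! hc
    exact hb (w.basis.ext_elem fun a => by simpa using hc a)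
  have := w.wt_eq_of_coord_ne_zero (lie_mem_wtSpace hx (w.basis_mem b)) ha
  have hab : w.wt a - w.wt b = α := by rw [this, add_sub_cancel_right]
  exact ⟨a, b, by rw [rel, hab]; exact hα, hab⟩

/-- A functional on weights testing membership of the indices in a given set. -/
lemma exists_indicator (s : Set X) : ∃ L : Module.Dual K (Module.Dual K S.h),
    ∀ a, L (w.wt a) = open scoped Classical in if a ∈ s then 1 else 0 := by
  classical
  let B := Module.Basis.extend w.linearIndependent_wt.linearIndepOn_id
  refine ⟨B.constr K fun i => if ∃ a ∈ s, w.wt a = i then 1 else 0, fun a => ?_⟩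
  have ha : w.wt a ∈ w.linearIndependent_wt.linearIndepOn_id.extend (Set.subset_univ _) :=
    Module.Basis.subset_extend _ ⟨a, rfl⟩
  have hB : B ⟨w.wt a, ha⟩ = w.wt a := Module.Basis.extend_apply_self _ _
  rw [← hB, Module.Basis.constr_basis]
  simp [w.wt_injective.eq_iff]

include hV in
lemma finite_between (hD : S.IsDynkin) {a b : X} (hab : w.rel a b) :
    {c : X | w.rel a c ∧ w.rel c b}.Finite := by
  classical
  have := w.isStrictTotalOrder_rel hV
  choose L hL using fun c : X => w.exists_indicator {a | a = c ∨ w.rel a c}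
  have key : ∀ α ∈ AddSubmonoid.closure S.simples, {c | L c α ≠ 0}.Finite := by
    intro α hα
    induction hα using AddSubmonoid.closure_induction with
    | zero => simp
    | add α β _ _ h h' =>
      refine (h.union h').subset fun c hc => ?_
      by_contra hn
      simp only [Set.mem_union, Set.mem_ofPred_eq, not_or, not_not] at hn
      exact hc (by rw [map_add, hn.1, hn.2, add_zero])
    | mem α hα =>
      obtain ⟨a, b, hab, rfl⟩ := w.exists_rel_of_mem_Φp hV hα.1
      refine (Set.finite_singleton a).subset fun c hc => ?_
      by_contra hne
      refine hc ?_
      rw [map_sub, hL, hL]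
      have hcov : ¬ (w.rel a c ∧ w.rel c b) := fun h =>
        hα.2 ⟨_, h.1, _, h.2, sub_add_sub_cancel _ _ _⟩
      have hiff : (a = c ∨ w.rel a c) ↔ (b = c ∨ w.rel b c) := by
        constructor
        · rintro (rfl | h)
          · exact absurd rfl hne
          · rcases trichotomous_of w.rel b c with h' | h' | h'
            · exact Or.inr h'
            · exact Or.inl h'
            · exact absurd ⟨h, h'⟩ hcov
        · rintro (rfl | h)
          · exact Or.inr hab
          · exact Or.inr (_root_.trans hab h)
      have ha : a ∈ {a | a = c ∨ w.rel a c} ↔ b ∈ {a | a = c ∨ w.rel a c} := hiff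
      by_cases h : b ∈ {a | a = c ∨ w.rel a c}
      · rw [if_pos (ha.2 h), if_pos h, sub_self]
      · rw [if_neg (mt ha.1 h), if_neg h, sub_self]
  refine (key _ (hD _ hab)).subset fun c hc => ?_
  have h1 : (a = c ∨ w.rel a c) := Or.inr hc.1
  have h2 : ¬ (b = c ∨ w.rel b c) := by
    rintro (rfl | h)
    · exact w.not_rel_of_rel hc.2 hc.2
    · exact w.not_rel_of_rel hc.2 h
  simp only [Set.mem_ofPred_eq, map_sub, hL, if_pos h1, if_neg h2]
  simp

end WeightBasis

lemma IsFinitaryAction.exists_matrixUnits {V : Type} [AddCommGroup V] [Module K V]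
    [LieRingModule g V] [LieModule K g V] {D : Submodule K (Module.Dual K V)}
    (hV : IsFinitaryAction K g V D) (hinf : ¬ Module.Finite K V)
    (S : RootReductive K g) (hD : S.IsDynkin) :
    ∃ (X : Type) (_ : LinearOrder X), Infinite X ∧ Nonempty (MatrixUnits S X) := by
  classical
  obtain ⟨X, ⟨w⟩⟩ := hV.exists_weightBasis S
  have := w.isStrictTotalOrder_rel hV
  let _ : LinearOrder X := linearOrderOfSTO w.rel
  obtain ⟨E, hE, hrepr⟩ := w.exists_unitBasis hV
  refine ⟨X, inferInstance, ?_, ⟨{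
    E := E
    lie_E := fun a b c d => ?_
    diag_mem := fun a => ?_
    h_le := ?_
    b_le := ?_
    finite_Icc := fun a b => ?_ }⟩⟩
  · by_contra hfin
    rw [not_infinite_iff_finite] at hfin
    exact hinf (Module.Finite.of_basis w.basis)
  · simp only [hE, w.lie_unit hV]
    split_ifs <;> rfl
  · rw [hE, w.unit_diag]
    exact (w.proj a).2
  · intro f hf
    rw [← E.linearCombination_repr f, Finsupp.linearCombination_apply]
    refine Submodule.sum_mem _ fun p hp => Submodule.smul_mem _ _ ?_
    obtain ⟨a, b⟩ := p
    rw [Finsupp.mem_support_iff, hrepr] at hp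
    have hab := w.wt_eq_of_coord_ne_zero
      (lie_mem_wtSpace (S.h_le_rootSp_zero hf) (w.basis_mem b)) hp
    rw [zero_add] at hab
    obtain rfl := w.wt_injective hab
    exact Submodule.subset_span ⟨a, rfl⟩
  · have hroot : ∀ α, (α = 0 ∨ α ∈ S.Φp) →
        rootSp K g S.h α ≤ Submodule.span K (E '' {p | p.1 ≤ p.2}) := by
      intro α hα f hf
      rw [← E.linearCombination_repr f, Finsupp.linearCombination_apply]
      refine Submodule.sum_mem _ fun p hp => Submodule.smul_mem _ _ ?_
      obtain ⟨a, b⟩ := p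
      rw [Finsupp.mem_support_iff, hrepr] at hp
      have hab := w.wt_eq_of_coord_ne_zero
        (lie_mem_wtSpace hf (w.basis_mem b)) hp
      refine Submodule.subset_span ⟨(a, b), ?_, rfl⟩
      rcases hα with rfl | hα
      · rw [zero_add] at hab
        exact (w.wt_injective hab).le
      · have : a < b := by
          change w.rel a b
          rw [WeightBasis.rel, hab, add_sub_cancel_right]
          exact hα
        exact le_of_lt this
    rw [S.b_def]
    exact sup_le (S.h_le_rootSp_zero.trans (hroot 0 (Or.inl rfl)))
      (iSup₂_le fun α hα => hroot α (Or.inr hα))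
  · rcases lt_or_ge a b with hab | hab
    · refine ((w.finite_between hV hD hab).union (Set.toFinite {a, b})).subset fun c hc => ?_
      rcases eq_or_lt_of_le hc.1 with rfl | h1
      · simp
      · rcases eq_or_lt_of_le hc.2 with rfl | h2
        · simp
        · exact Or.inl ⟨h1, h2⟩
    · exact (Set.finite_singleton a).subset fun c hc => le_antisymm (hc.2.trans hab) hc.1

section NaturalRepresentation

/-- The natural representation of `gl_∞`. -/
@[reducible] def glInfNatLieRingModule : LieRingModule (glInf K) (ℕ →₀ K) where
  bracket f v := f.1 v
  add_lie f f' v := LinearMap.add_apply f.1 f'.1 v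
  lie_add f v v' := map_add f.1 v v'
  leibniz_lie f f' v := by
    change f.1 (f'.1 v) = (f.1 * f'.1 - f'.1 * f.1 : Module.End K (ℕ →₀ K)) v + f'.1 (f.1 v)
    simp

attribute [local instance] glInfNatLieRingModule

lemma glInfNatLieModule : LieModule K (glInf K) (ℕ →₀ K) where
  smul_lie c f v := LinearMap.smul_apply c f.1 v
  lie_smul c f v := map_smul f.1 c v

attribute [local instance] glInfNatLieModule

/-- The functionals on `⊕_ℕ K` with only finitely many non-zero coordinates. -/
def finitaryDual : Submodule K (Module.Dual K (ℕ →₀ K)) where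
  carrier := {ψ | {j : ℕ | ψ (Finsupp.single j 1) ≠ 0}.Finite}
  add_mem' := by
    intro ψ ψ' h h'
    refine (h.union h').subset fun j hj => ?_
    by_contra hn
    simp only [Set.mem_union, Set.mem_ofPred_eq, not_or, not_not] at hn
    exact hj (by rw [LinearMap.add_apply, hn.1, hn.2, add_zero])
  zero_mem' := by simp
  smul_mem' := by
    intro c ψ h
    refine h.subset fun j hj hn => hj ?_
    rw [LinearMap.smul_apply, hn, smul_zero]

lemma lapply_mem_finitaryDual (j : ℕ) :
    (Finsupp.lapply j : (ℕ →₀ K) →ₗ[K] K) ∈ finitaryDual (K := K) :=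
  (Set.finite_singleton j).subset fun i hi => by
    by_contra hn
    exact hi (Finsupp.single_eq_of_ne' hn)

lemma glInf_isFinitaryAction :
    IsFinitaryAction K (glInf K) (ℕ →₀ K) finitaryDual where
  faithful f hf := Subtype.ext (LinearMap.ext fun v => hf v)
  exists_rankOne v ψ hψ := by
    refine ⟨⟨ψ.smulRight v, hψ.subset fun j hj hn => hj ?_⟩, fun u => rfl⟩
    change ψ (Finsupp.single j 1) • v = 0
    rw [hn, zero_smul]
  exists_dual u hu := by
    obtain ⟨j, hj⟩ := Finsupp.ne_iff.1 hu
    refine ⟨(u j)⁻¹ • Finsupp.lapply j, Submodule.smul_mem _ _ (lapply_mem_finitaryDual j), ?_⟩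
    exact inv_mul_cancel₀ hj
  exists_sum f := by
    classical
    obtain ⟨f, hf⟩ := f
    change {j : ℕ | f (Finsupp.single j 1) ≠ 0}.Finite at hf
    let s := hf.toFinset
    refine ⟨s.card, fun i => f (Finsupp.single (s.equivFin.symm i : ℕ) 1),
      fun i => Finsupp.lapply (s.equivFin.symm i : ℕ), fun i => lapply_mem_finitaryDual _, ?_⟩
    intro u
    change f u = _
    rw [s.equivFin.symm.sum_comp
      fun j : s => (Finsupp.lapply (j : ℕ) : (ℕ →₀ K) →ₗ[K] K) u • f (Finsupp.single (j : ℕ) 1)]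
    rw [Finset.sum_coe_sort s fun j => (Finsupp.lapply j : (ℕ →₀ K) →ₗ[K] K) u •
      f (Finsupp.single j 1)]
    conv_lhs => rw [← Finsupp.sum_single u, Finsupp.sum, map_sum]
    have h : ∀ j, f (Finsupp.single j (u j)) = u j • f (Finsupp.single j 1) := fun j => by
      rw [← map_smul, Finsupp.smul_single, smul_eq_mul, mul_one]
    simp only [h, Finsupp.lapply_apply]
    have h1 : ∑ j ∈ u.support, u j • f (Finsupp.single j 1) =
        ∑ j ∈ u.support ∪ s, u j • f (Finsupp.single j 1) :=
      Finset.sum_subset Finset.subset_union_left fun j _ hj => by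
        rw [Finsupp.notMem_support_iff.1 hj, zero_smul]
    have h2 : ∑ j ∈ s, u j • f (Finsupp.single j 1) =
        ∑ j ∈ u.support ∪ s, u j • f (Finsupp.single j 1) :=
      Finset.sum_subset Finset.subset_union_right fun j _ hj => by
        have : f (Finsupp.single j 1) = 0 := by
          by_contra hn
          exact hj (hf.mem_toFinset.2 hn)
        rw [this, smul_zero]
    rw [h1, h2]

lemma exists_matrixUnits_glInf (S : RootReductive K (glInf K)) (hD : S.IsDynkin) :
    ∃ (X : Type) (_ : LinearOrder X), Infinite X ∧ Nonempty (MatrixUnits S X) := by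
  refine glInf_isFinitaryAction.exists_matrixUnits (fun h => ?_) S hD
  have := Module.Finite.finite_basis (Finsupp.basisSingleOne (R := K) (ι := ℕ))
  exact not_finite ℕ

end NaturalRepresentation

/-- A linear map respecting brackets of basis elements, as a morphism of Lie algebras. -/
def lieHomOfBasis {I L : Type} [LieRing L] [LieAlgebra K L] (E : Module.Basis I K g)
    (f : g →ₗ[K] L) (hf : ∀ i j, f ⁅E i, E j⁆ = ⁅f (E i), f (E j)⁆) : g →ₗ⁅K⁆ L where
  __ := f
  map_lie' {x y} := by
    have h : (LieModule.toEnd K g g : g →ₗ[K] Module.End K g).compr₂ f =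
        (LieModule.toEnd K L L : L →ₗ[K] Module.End K L).compl₁₂ f f :=
      E.ext fun i => E.ext fun j => hf i j
    exact LinearMap.congr_fun₂ h x y

section Polynomials

variable {X : Type} [LinearOrder X]

/-- The indices of the coordinates: triples `(p, c, i)` with `c ≤ p < i`. -/
abbrev CoordIndex (X : Type) [LinearOrder X] : Type :=
  {t : X × X × X // t.2.1 ≤ t.1 ∧ t.1 < t.2.2}

variable (K) in
/-- The coordinate `(c, i)` of the point `p`: a polynomial variable for `c ≤ p < i`, and the
Kronecker symbol otherwise. -/
def coordG (p c i : X) : MvPolynomial (CoordIndex X) K :=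
  if h : c ≤ p ∧ p < i then MvPolynomial.X ⟨(p, c, i), h⟩ else if c = i then 1 else 0

variable (K) in
/-- The coordinates complementary to `coordG`. -/
def coordH (p c a : X) : MvPolynomial (CoordIndex X) K :=
  (if c = a then 1 else 0) - if p < a then coordG K p c a else 0

lemma coordG_of_mem {p c i : X} (hc : c ≤ p) (hi : p < i) :
    coordG K p c i = MvPolynomial.X ⟨(p, c, i), hc, hi⟩ := dif_pos ⟨hc, hi⟩

lemma coordG_of_lt {p c : X} (hc : p < c) (i : X) :
    coordG K p c i = if c = i then 1 else 0 := dif_neg fun h => h.1.not_gt hc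

lemma coordH_of_lt {p c : X} (hc : p < c) (a : X) : coordH K p c a = 0 := by
  rw [coordH, coordG_of_lt hc]
  rcases eq_or_ne c a with rfl | h
  · simp [hc]
  · simp [h]

lemma coordH_of_le {p a : X} (ha : a ≤ p) (c : X) :
    coordH K p c a = if c = a then 1 else 0 := by
  rw [coordH, if_neg ha.not_gt, sub_zero]

lemma coordH_of_le_of_lt {p c a : X} (hc : c ≤ p) (ha : p < a) :
    coordH K p c a = - coordG K p c a := by
  rw [coordH, if_neg (hc.trans_lt ha).ne, if_pos ha, zero_sub]

lemma coordH_add (p c a : X) :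
    coordH K p c a + (if p < a then coordG K p c a else 0) = if c = a then 1 else 0 :=
  sub_add_cancel _ _

variable (K) in
/-- The derivations by which the matrix units act, up to sign. -/
def coordD (a b : X) :
    Derivation K (MvPolynomial (CoordIndex X) K) (MvPolynomial (CoordIndex X) K) :=
  MvPolynomial.mkDerivation K fun t => coordH K t.1.1 t.1.2.1 a * coordG K t.1.1 b t.1.2.2

lemma coordD_coordG (a b : X) {p i : X} (c : X) (hi : p < i) :
    coordD K a b (coordG K p c i) = coordH K p c a * coordG K p b i := by
  rcases le_or_gt c p with hc | hc
  · rw [coordG_of_mem hc hi, coordD, MvPolynomial.mkDerivation_X]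
  · rw [coordH_of_lt hc, zero_mul, coordG_of_lt hc]
    split_ifs <;> simp

lemma coordD_coordH (a b p e c : X) :
    coordD K a b (coordH K p e c) =
      - ((if p < c then coordG K p b c else 0) * coordH K p e a) := by
  have h1 : coordD K a b (if e = c then 1 else 0) = 0 := by split_ifs <;> simp
  rw [coordH, map_sub, h1]
  split_ifs with h
  · rw [coordD_coordG a b e h]
    ring
  · simp

lemma lie_coordD (a b c d : X) :
    ⁅coordD K a b, coordD K c d⁆ =
      (if d = a then coordD K c b else 0) - if b = c then coordD K a d else 0 := by
  refine MvPolynomial.derivation_ext fun ⟨⟨p, e, i⟩, he, hi⟩ => ?_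
  have h1 := coordH_add (K := K) p d a
  have h2 := coordH_add (K := K) p b c
  have h : ⁅coordD K a b, coordD K c d⁆ (coordG K p e i) =
      (if d = a then 1 else 0) * (coordH K p e c * coordG K p b i) -
        (if b = c then 1 else 0) * (coordH K p e a * coordG K p d i) := by
    rw [Derivation.commutator_apply, coordD_coordG _ _ _ hi, coordD_coordG _ _ _ hi,
      Derivation.leibniz, Derivation.leibniz, coordD_coordG _ _ _ hi, coordD_coordG _ _ _ hi,
      coordD_coordH, coordD_coordH, ← h1, ← h2]
    simp only [smul_eq_mul]
    ring
  dsimp only at he hi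
  rw [← coordG_of_mem he hi, h]
  split_ifs <;> simp [coordD_coordG _ _ _ hi]

variable (K) in
/-- The values of the cocycle attached to `p` on matrix units. -/
def coordCocycle (p a b : X) : MvPolynomial (CoordIndex X) K :=
  if p < a then coordG K p b a else 0

lemma coordCocycle_lie (p a b c d : X) :
    coordD K c d (coordCocycle K p a b) - coordD K a b (coordCocycle K p c d) =
      (if b = c then coordCocycle K p a d else 0) -
        if d = a then coordCocycle K p c b else 0 := by
  have h1 := coordH_add (K := K) p d a
  have h2 := coordH_add (K := K) p b c
  have h3 : ∀ a b c d : X, coordD K c d (coordCocycle K p a b) =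
      coordH K p b c * coordCocycle K p a d := by
    intro a b c d
    rw [coordCocycle, coordCocycle]
    split_ifs with h
    · rw [coordD_coordG _ _ _ h]
    · simp
  have h4 : ∀ (P : Prop) [Decidable P] (r : MvPolynomial (CoordIndex X) K),
      (if P then r else 0) = (if P then 1 else 0) * r := by
    intro P _ r
    split_ifs <;> simp
  rw [h3, h3, h4 (b = c), h4 (d = a), ← h1, ← h2]
  simp only [coordCocycle]
  ring

/-- The indices of the cocycles: the non-maximal elements. -/
abbrev CocycleIndex (X : Type) [LinearOrder X] : Type := {p : X // ¬ IsMax p}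

variable (K) in
/-- The matrix units acting on the extension of the space of cocycles by polynomials. -/
def cocycleEnd (a b : X) :
    Module.End K (MvPolynomial (CoordIndex X) K × (CocycleIndex X →₀ K)) :=
  LinearMap.inl K _ _ ∘ₗ (- (coordD K a b).toLinearMap).coprod
    (Finsupp.linearCombination K fun p : CocycleIndex X => coordCocycle K p.1 a b)

lemma cocycleEnd_inl (a b : X) (r : MvPolynomial (CoordIndex X) K) :
    cocycleEnd K a b (r, 0) = (- coordD K a b r, 0) := by
  simp [cocycleEnd]

lemma cocycleEnd_single (a b : X) (p : CocycleIndex X) :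
    cocycleEnd K a b (0, Finsupp.single p 1) = (coordCocycle K p.1 a b, 0) := by
  simp [cocycleEnd]

lemma lie_cocycleEnd (a b c d : X) :
    ⁅cocycleEnd K a b, cocycleEnd K c d⁆ =
      (if b = c then cocycleEnd K a d else 0) - if d = a then cocycleEnd K c b else 0 := by
  refine LinearMap.prod_ext (LinearMap.ext fun r => ?_) (Finsupp.lhom_ext' fun p =>
    LinearMap.ext_ring ?_)
  · have h := DFunLike.congr_fun (lie_coordD (K := K) a b c d) r
    rw [Derivation.commutator_apply] at h
    have hl : ⁅cocycleEnd K a b, cocycleEnd K c d⁆ =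
      cocycleEnd K a b * cocycleEnd K c d - cocycleEnd K c d * cocycleEnd K a b := rfl
    rw [hl]
    simp only [LinearMap.comp_apply, LinearMap.inl_apply, LinearMap.sub_apply,
      Module.End.mul_apply, cocycleEnd_inl, map_neg, neg_neg, Prod.mk_sub_mk, sub_zero]
    rw [h]
    split_ifs <;> simp [cocycleEnd_inl]
    ring
  · have h := coordCocycle_lie (K := K) p.1 a b c d
    have hl : ⁅cocycleEnd K a b, cocycleEnd K c d⁆ =
      cocycleEnd K a b * cocycleEnd K c d - cocycleEnd K c d * cocycleEnd K a b := rfl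
    rw [hl]
    simp only [LinearMap.comp_apply, LinearMap.inr_apply, LinearMap.sub_apply,
      Module.End.mul_apply, Finsupp.lsingle_apply, cocycleEnd_single, cocycleEnd_inl,
      Prod.mk_sub_mk, sub_zero]
    rw [neg_sub_neg, h]
    split_ifs <;> simp [cocycleEnd_single]

end Polynomials

lemma ueaAdjoin_range_ι : Algebra.adjoin K (Set.range (ι K : g → UEA K g)) = ⊤ := by
  let A := Algebra.adjoin K (Set.range (ι K : g → UEA K g))
  let j : g →ₗ⁅K⁆ A :=
    { toFun := fun x => ⟨ι K x, Algebra.subset_adjoin ⟨x, rfl⟩⟩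
      map_add' := fun x y => Subtype.ext (map_add _ x y)
      map_smul' := fun c x => Subtype.ext (map_smul _ c x)
      map_lie' := fun {x y} => Subtype.ext ((ι K).map_lie x y) }
  have h : A.val.comp (lift K j) = AlgHom.id K (UEA K g) := by
    refine UniversalEnvelopingAlgebra.hom_ext K (LieHom.ext fun x => ?_)
    change ((lift K j (ι K x) : A) : UEA K g) = ι K x
    rw [lift_ι_apply]
    rfl
  exact eq_top_iff.2 fun u _ => by
    rw [← AlgHom.id_apply (R := K) u, ← h]
    exact (lift K j u).2

section UEAModules

variable {M N : Type} [AddCommGroup M] [Module K M] [Module (UEA K g) M]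
  [IsScalarTower K (UEA K g) M] [AddCommGroup N] [Module K N] [Module (UEA K g) N]
  [IsScalarTower K (UEA K g) N]

/-- A `K`-linear map commuting with the action of `g` is `U(g)`-linear. -/
def ueaLinearMap (f : M →ₗ[K] N) (hf : ∀ (x : g) (m : M), f (ι K x • m) = ι K x • f m) :
    M →ₗ[UEA K g] N where
  toFun := f
  map_add' := map_add f
  map_smul' u m := by
    have hu : u ∈ Algebra.adjoin K (Set.range (ι K : g → UEA K g)) :=
      ueaAdjoin_range_ι (K := K) (g := g) ▸ Algebra.mem_top
    induction hu using Algebra.adjoin_induction generalizing m with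
    | mem u hu => obtain ⟨x, rfl⟩ := hu; exact hf x m
    | algebraMap c => simp only [RingHom.id_apply, algebraMap_smul, map_smul]
    | add u v _ _ hu hv =>
      simp only [RingHom.id_apply] at hu hv ⊢
      rw [add_smul, map_add, hu, hv, add_smul]
    | mul u v _ _ hu hv =>
      simp only [RingHom.id_apply, mul_smul] at hu hv ⊢
      rw [hu, hv]

@[simp] lemma ueaLinearMap_apply (f : M →ₗ[K] N)
    (hf : ∀ (x : g) (m : M), f (ι K x • m) = ι K x • f m) (m : M) :
    ueaLinearMap f hf m = f m := rfl

lemma isLocFin_iff (S : RootReductive K g) : S.IsLocFin M ↔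
    ∀ m : M, ∃ N : Submodule K M, m ∈ N ∧ FiniteDimensional K N ∧
      ∀ x ∈ S.b, ∀ v ∈ N, (ι K x) • v ∈ N := by
  have h : Module.compHom M (algebraMap K (UEA K g)) = ‹Module K M› :=
    Module.ext' _ _ fun c m => algebraMap_smul (UEA K g) c m
  rw [RootReductive.IsLocFin, h]

lemma mem_wtSet_iff {S : RootReductive K g} {χ : Module.Dual K S.h} {m : M} :
    m ∈ S.wtSet M χ ↔ ∀ H : S.h, ι K (H : g) • m = χ H • m := by
  simp only [RootReductive.wtSet, Set.mem_ofPred_eq, algebraMap_smul]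

lemma map_mem_wtSet {S : RootReductive K g} (f : M →ₗ[UEA K g] N) {χ : Module.Dual K S.h} {m : M}
    (hm : m ∈ S.wtSet M χ) : f m ∈ S.wtSet N χ := fun H => by
  rw [← map_smul, hm H, map_smul]

omit [Module K M] [Module K N] [IsScalarTower K (UEA K g) M] [IsScalarTower K (UEA K g) N] in
/-- A module generated by an image of a module of category `O` and vectors killed by `b`
is in category `O`. -/
lemma inO_of_forall_exists_add {S : RootReductive K g} (hM : S.InO M) (f : M →ₗ[UEA K g] N)
    (hf : ∀ n : N, ∃ m n', n = f m + n' ∧ ∀ x ∈ S.b, ι K x • n' = 0) : S.InO N := by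
  let _ : Module K M := Module.compHom M (algebraMap K (UEA K g))
  let _ : Module K N := Module.compHom N (algebraMap K (UEA K g))
  have : IsScalarTower K (UEA K g) M := ⟨fun c u m => by
    rw [Algebra.smul_def, mul_smul]; rfl⟩
  have : IsScalarTower K (UEA K g) N := ⟨fun c u m => by
    rw [Algebra.smul_def, mul_smul]; rfl⟩
  refine ⟨fun n => ?_, (isLocFin_iff S).2 fun n => ?_⟩
  · obtain ⟨m, n', rfl, hn'⟩ := hf n
    refine add_mem ?_ (AddSubgroup.subset_closure
      (Set.mem_iUnion.2 ⟨0, mem_wtSet_iff.2 fun H => ?_⟩))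
    · induction hM.1 m using AddSubgroup.closure_induction with
      | mem m hm =>
        obtain ⟨χ, hχ⟩ := Set.mem_iUnion.1 hm
        exact AddSubgroup.subset_closure (Set.mem_iUnion.2 ⟨χ, map_mem_wtSet f hχ⟩)
      | zero => rw [map_zero]; exact zero_mem _
      | add m m' _ _ h h' => rw [map_add]; exact add_mem h h'
      | neg m _ h => rw [map_neg]; exact neg_mem h
    · rw [hn' _ (S.h_le_b H.2), LinearMap.zero_apply, zero_smul]
  · obtain ⟨m, n', rfl, hn'⟩ := hf n
    obtain ⟨F, hm, hF, hb⟩ := (isLocFin_iff S).1 hM.2 m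
    refine ⟨F.map (f.restrictScalars K) ⊔ Submodule.span K {n'},
      Submodule.add_mem_sup ⟨m, hm, rfl⟩ (Submodule.mem_span_singleton_self n'),
      inferInstance, fun x hx v hv => ?_⟩
    obtain ⟨_, ⟨v, hvF, rfl⟩, w, hw, rfl⟩ := Submodule.mem_sup.1 hv
    obtain ⟨c, rfl⟩ := Submodule.mem_span_singleton.1 hw
    rw [smul_add, smul_comm, hn' x hx, smul_zero, add_zero]
    exact Submodule.mem_sup_left ⟨_, hb x hx v hvF, map_smul f _ _⟩

omit [Module K M] [Module K N] [IsScalarTower K (UEA K g) M] [IsScalarTower K (UEA K g) N] in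
lemma inO_of_surjective {S : RootReductive K g} (hM : S.InO M) (f : M →ₗ[UEA K g] N)
    (hf : Function.Surjective f) : S.InO N :=
  inO_of_forall_exists_add hM f fun n => by
    obtain ⟨m, rfl⟩ := hf n
    exact ⟨m, 0, (add_zero _).symm, fun x _ => smul_zero _⟩

omit [Module K M] [IsScalarTower K (UEA K g) M] in
/-- Every vector of a weight module is a sum of weight vectors of distinct weights. -/
lemma exists_weight_components {S : RootReductive K g} (hM : S.IsWeightMod M) (m : M) :
    ∃ F : Module.Dual K S.h →₀ M, (∀ χ, F χ ∈ S.wtSet M χ) ∧ (F.sum fun _ v => v) = m := by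
  classical
  induction hM m using AddSubgroup.closure_induction with
  | mem m hm =>
    obtain ⟨χ, hχ⟩ := Set.mem_iUnion.1 hm
    refine ⟨Finsupp.single χ m, fun χ' => ?_, by simp⟩
    rw [Finsupp.single_apply]
    split_ifs with h
    · exact h ▸ hχ
    · intro H; simp
  | zero => exact ⟨0, fun χ H => by simp, by simp⟩
  | add m m' _ _ h h' =>
    obtain ⟨F, hF, rfl⟩ := h
    obtain ⟨F', hF', rfl⟩ := h'
    refine ⟨F + F', fun χ H => ?_, Finsupp.sum_add_index' (fun _ => rfl) fun _ _ _ => rfl⟩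
    rw [Finsupp.add_apply, smul_add, smul_add, hF χ H, hF' χ H]
  | neg m _ h =>
    obtain ⟨F, hF, rfl⟩ := h
    refine ⟨-F, fun χ H => ?_, ?_⟩
    · rw [Finsupp.neg_apply, smul_neg, smul_neg, hF χ H]
    · rw [Finsupp.sum_neg_index fun _ => rfl, Finsupp.sum, Finsupp.sum, Finset.sum_neg_distrib]

omit [Module K M] [IsScalarTower K (UEA K g) M] in
lemma eq_zero_of_sum_wtSet_eq_zero {S : RootReductive K g} {F : Module.Dual K S.h → M}
    (hF : ∀ χ, F χ ∈ S.wtSet M χ) (s : Finset (Module.Dual K S.h)) (hs : ∑ χ ∈ s, F χ = 0) :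
    ∀ χ ∈ s, F χ = 0 := by
  let _ : Module K M := Module.compHom M (algebraMap K (UEA K g))
  have : IsScalarTower K (UEA K g) M := ⟨fun c u m => by
    rw [Algebra.smul_def, mul_smul]; rfl⟩
  let _ : LieRingModule g M :=
    { bracket := fun x m => ι K x • m
      add_lie := fun x y m => by
        rw [map_add, add_smul]
      lie_add := fun x m n => smul_add _ m n
      leibniz_lie := fun x y m => by
        change ι K x • ι K y • m = ι K ⁅x, y⁆ • m + ι K y • ι K x • m
        rw [LieHom.map_lie, LieRing.of_associative_ring_bracket, sub_smul, mul_smul, mul_smul,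
          sub_add_cancel] }
  have : LieModule K g M :=
    { smul_lie := fun c x m => by
        change ι K (c • x) • m = c • ι K x • m
        rw [map_smul, smul_assoc]
      lie_smul := fun c x m => by
        change ι K x • c • m = c • ι K x • m
        rw [smul_comm] }
  exact iSupIndep_iff_finsetSum_eq_zero_imp_eq_zero _ |>.1 (iSupIndep_wtSpace S.h M) s F
    (fun χ _ => hF χ) hs

omit [Module K M] [Module K N] [IsScalarTower K (UEA K g) M] [IsScalarTower K (UEA K g) N] in
lemma inO_ker {S : RootReductive K g} (hM : S.InO M) (f : M →ₗ[UEA K g] N) :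
    S.InO (LinearMap.ker f) := by
  let _ : Module K M := Module.compHom M (algebraMap K (UEA K g))
  have : IsScalarTower K (UEA K g) M := ⟨fun c u m => by
    rw [Algebra.smul_def, mul_smul]; rfl⟩
  refine ⟨fun m => ?_, (isLocFin_iff S).2 fun m => ?_⟩
  · obtain ⟨F, hF, hm⟩ := exists_weight_components hM.1 m.1
    have hker : ∀ χ ∈ F.support, f (F χ) = 0 := by
      refine eq_zero_of_sum_wtSet_eq_zero (fun χ => ?_) F.support ?_
      · intro H; rw [← map_smul, hF χ H, map_smul]
      · rw [← map_sum]
        exact (congrArg f hm).trans m.2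
    have : m = ∑ χ ∈ F.support.attach, ⟨F χ.1, hker χ.1 χ.2⟩ := by
      refine Subtype.ext ?_
      rw [← hm, AddSubmonoidClass.coe_finsetSum]
      exact (Finset.sum_attach F.support F).symm
    rw [this]
    refine sum_mem fun χ _ => AddSubgroup.subset_closure (Set.mem_iUnion.2 ⟨χ.1, fun H => ?_⟩)
    exact Subtype.ext (hF χ.1 H)
  · obtain ⟨W, hm, hW, hb⟩ := (isLocFin_iff S).1 hM.2 m.1
    refine ⟨W.comap ((LinearMap.ker f).subtype.restrictScalars K), hm, ?_, fun x hx v hv =>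
      hb x hx v.1 hv⟩
    refine Module.Finite.of_injective
      (((LinearMap.ker f).subtype.restrictScalars K).restrict fun _ h => h) fun v w h => ?_
    have h' := congrArg Subtype.val h
    exact Subtype.ext (Subtype.ext h')

end UEAModules

/-- The `U(g)`-module attached to a representation of `g`. -/
def RepMod {V : Type} [AddCommGroup V] [Module K V] (_ : g →ₗ⁅K⁆ Module.End K V) : Type := V

section RepMod

variable {V : Type} [AddCommGroup V] [Module K V] (r : g →ₗ⁅K⁆ Module.End K V)

instance : AddCommGroup (RepMod r) := inferInstanceAs (AddCommGroup V)

instance : Module K (RepMod r) := inferInstanceAs (Module K V)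

/-- The underlying vector space of `RepMod`. -/
def RepMod.of : V ≃ₗ[K] RepMod r := LinearEquiv.refl K V

instance : Module (UEA K g) (RepMod r) :=
  Module.compHom V (lift K r).toRingHom

lemma RepMod.ι_smul (x : g) (v : V) : ι K x • RepMod.of r v = RepMod.of r (r x v) := by
  change lift K r (ι K x) v = r x v
  rw [lift_ι_apply]

instance : IsScalarTower K (UEA K g) (RepMod r) where
  smul_assoc c u v := by
    change lift K r (c • u) v = c • lift K r u v
    rw [map_smul]
    rfl

lemma RepMod.forall {P : RepMod r → Prop} (h : ∀ v, P (RepMod.of r v)) (m : RepMod r) : P m :=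
  h m

end RepMod

namespace MatrixUnits

variable {S : RootReductive K g} {X : Type} [LinearOrder X] (M : MatrixUnits S X)

/-- The action of `g` on polynomials by derivations. -/
def polyDer :
    g →ₗ⁅K⁆ Derivation K (MvPolynomial (CoordIndex X) K) (MvPolynomial (CoordIndex X) K) :=
  lieHomOfBasis M.E (M.E.constr K fun p => - coordD K p.1 p.2) fun ⟨a, b⟩ ⟨c, d⟩ => by
    simp only [Module.Basis.constr_basis, M.lie_E, map_sub, neg_lie, lie_neg, neg_neg,
      lie_coordD]
    split_ifs
    all_goals simp
    abel

lemma polyDer_E (a b : X) : M.polyDer (M.E (a, b)) = - coordD K a b :=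
  M.E.constr_basis K _ _

/-- The representation of `g` on polynomials. -/
def polyRep : g →ₗ⁅K⁆ Module.End K (MvPolynomial (CoordIndex X) K) where
  toFun x := (M.polyDer x).toLinearMap
  map_add' x y := by rw [map_add]; rfl
  map_smul' c x := by rw [map_smul]; rfl
  map_lie' {x y} := by rw [LieHom.map_lie]; exact Derivation.commutator_coe_linear_map

lemma polyRep_apply (x : g) (q : MvPolynomial (CoordIndex X) K) :
    M.polyRep x q = M.polyDer x q := rfl

lemma polyRep_E (a b : X) (q : MvPolynomial (CoordIndex X) K) :
    M.polyRep (M.E (a, b)) q = - coordD K a b q := by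
  rw [polyRep_apply, polyDer_E]
  rfl

/-- The representation of `g` on the extension of the space of cocycles by polynomials. -/
def cocycleRep :
    g →ₗ⁅K⁆ Module.End K (MvPolynomial (CoordIndex X) K × (CocycleIndex X →₀ K)) :=
  lieHomOfBasis M.E (M.E.constr K fun p => cocycleEnd K p.1 p.2) fun ⟨a, b⟩ ⟨c, d⟩ => by
    simp only [Module.Basis.constr_basis, M.lie_E, map_sub]
    refine Eq.trans ?_ (lie_cocycleEnd a b c d).symm
    split_ifs
    · simp
    · simp
    · simp
    · rw [map_zero]

lemma cocycleRep_E (a b : X) : M.cocycleRep (M.E (a, b)) = cocycleEnd K a b :=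
  M.E.constr_basis K _ _

lemma cocycleRep_inl (x : g) (q : MvPolynomial (CoordIndex X) K) :
    M.cocycleRep x (q, 0) = (M.polyRep x q, 0) := by
  induction M.E.mem_span x using Submodule.span_induction with
  | mem x hx =>
    obtain ⟨⟨a, b⟩, rfl⟩ := hx
    rw [cocycleRep_E, cocycleEnd_inl, polyRep_E]
  | zero => simp; rfl
  | add x y _ _ hx hy =>
    rw [map_add, map_add, LinearMap.add_apply, LinearMap.add_apply, hx, hy, Prod.mk_add_mk,
      add_zero]
  | smul c x _ hx =>
    rw [map_smul, map_smul, LinearMap.smul_apply, LinearMap.smul_apply, hx, Prod.smul_mk, smul_zero]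

lemma snd_cocycleRep (x : g) (w : MvPolynomial (CoordIndex X) K × (CocycleIndex X →₀ K)) :
    (M.cocycleRep x w).2 = 0 := by
  induction M.E.mem_span x using Submodule.span_induction with
  | mem x hx =>
    obtain ⟨⟨a, b⟩, rfl⟩ := hx
    rw [cocycleRep_E]
    rfl
  | zero => simp
  | add x y _ _ hx hy => rw [map_add, LinearMap.add_apply, Prod.snd_add, hx, hy, add_zero]
  | smul c x _ hx => rw [map_smul, LinearMap.smul_apply, Prod.smul_snd, hx, smul_zero]

lemma apply_mem_of_mem_b {V : Type} [AddCommGroup V] [Module K V] (f : g →ₗ[K] V)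
    (W : Submodule K V) (hf : ∀ a b, a ≤ b → f (M.E (a, b)) ∈ W) {x : g} (hx : x ∈ S.b) :
    f x ∈ W := by
  have h : Submodule.span K (M.E '' {p | p.1 ≤ p.2}) ≤ W.comap f := by
    rw [Submodule.span_le]
    rintro _ ⟨⟨a, b⟩, hab, rfl⟩
    exact hf a b hab
  exact h (M.b_le hx)

lemma exists_weight {V : Type} [AddCommGroup V] [Module K V] (f : g →ₗ[K] V) (v : V) (s : X → K)
    (hs : ∀ b, f (M.E (b, b)) = s b • v) :
    ∃ χ : Module.Dual K S.h, ∀ H : S.h, f H = χ H • v := by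
  let L : g →ₗ[K] K := M.E.constr K fun p => s p.1
  have h : S.h.toSubmodule ≤ LinearMap.eqLocus f (L.smulRight v) := by
    refine M.h_le.trans (Submodule.span_le.2 ?_)
    rintro _ ⟨b, rfl⟩
    change f (M.E (b, b)) = L (M.E (b, b)) • v
    rw [hs, M.E.constr_basis]
  exact ⟨L ∘ₗ S.h.toSubmodule.subtype, fun H => h H.2⟩

variable (K) in
/-- The span of the coordinates of `p` between `c` and `i`. -/
def coordSpan (p c i : X) :
    Submodule K (MvPolynomial (CoordIndex X) K) :=
  Submodule.span K ({1} ∪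
    {q | ∃ c' ∈ Set.Icc c i, ∃ i' ∈ Set.Icc c i, p < i' ∧ q = coordG K p c' i'})

lemma coordD_mem_coordSpan {p c i a b : X} (hab : a ≤ b) {q : MvPolynomial (CoordIndex X) K}
    (hq : q ∈ coordSpan K p c i) : coordD K a b q ∈ coordSpan K p c i := by
  induction hq using Submodule.span_induction with
  | mem q hq =>
    obtain hq | ⟨c', hc', i', hi', hp, rfl⟩ := hq
    · rw [Set.mem_singleton_iff.1 hq, Derivation.map_one_eq_zero]
      exact zero_mem _
    have h1 : (1 : MvPolynomial (CoordIndex X) K) ∈ coordSpan K p c i :=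
      Submodule.subset_span (Or.inl rfl)
    rw [coordD_coordG _ _ _ hp]
    rcases lt_or_ge p c' with hc | hc
    · rw [coordH_of_lt hc, zero_mul]
      exact zero_mem _
    rcases lt_or_ge p a with ha | ha
    · rw [coordG_of_lt (ha.trans_le hab)]
      split_ifs with h
      · subst h
        rw [coordH_of_le_of_lt hc ha, mul_one]
        exact neg_mem (Submodule.subset_span (Or.inr
          ⟨c', hc', a, ⟨(hc'.1.trans hc).trans ha.le, hab.trans hi'.2⟩, ha, rfl⟩))
      · rw [mul_zero]
        exact zero_mem _
    · rw [coordH_of_le ha]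
      split_ifs with h
      · subst h
        rw [one_mul]
        rcases lt_or_ge p b with hb | hb
        · rw [coordG_of_lt hb]
          split_ifs
          exacts [h1, zero_mem _]
        · exact Submodule.subset_span (Or.inr
            ⟨b, ⟨hc'.1.trans hab, hb.trans (hp.le.trans hi'.2)⟩, i', hi', hp, rfl⟩)
      · rw [zero_mul]
        exact zero_mem _
  | zero => rw [map_zero]; exact zero_mem _
  | add q q' _ _ h h' => rw [map_add]; exact add_mem h h'
  | smul c q _ h => rw [Derivation.map_smul]; exact Submodule.smul_mem _ _ h

include M in
lemma finite_coordSpan (p c i : X) : FiniteDimensional K (coordSpan K p c i) := by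
  refine FiniteDimensional.span_of_finite K ((Set.finite_singleton 1).union
    ((((M.finite_Icc c i).prod (M.finite_Icc c i)).image
      fun t => coordG K p t.1 t.2).subset ?_))
  rintro _ ⟨c', hc', i', hi', -, rfl⟩
  exact ⟨(c', i'), ⟨hc', hi'⟩, rfl⟩

lemma exists_finite_stable (q : MvPolynomial (CoordIndex X) K) :
    ∃ W : Submodule K (MvPolynomial (CoordIndex X) K), q ∈ W ∧ FiniteDimensional K W ∧
      ∀ x ∈ S.b, ∀ v ∈ W, M.polyRep x v ∈ W := by
  induction q using MvPolynomial.induction_on with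
  | C c =>
    refine ⟨Submodule.span K {1}, ?_, inferInstance, fun x _ v hv => ?_⟩
    · exact Submodule.mem_span_singleton.2 ⟨c, (MvPolynomial.C_eq_smul_one).symm⟩
    · obtain ⟨c, rfl⟩ := Submodule.mem_span_singleton.1 hv
      rw [map_smul, polyRep_apply, Derivation.map_one_eq_zero, smul_zero]
      exact zero_mem _
  | add q q' h h' =>
    obtain ⟨W, hq, hW, hb⟩ := h
    obtain ⟨W', hq', hW', hb'⟩ := h'
    refine ⟨W ⊔ W', Submodule.add_mem_sup hq hq', inferInstance, fun x hx v hv => ?_⟩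
    obtain ⟨w, hw, w', hw', rfl⟩ := Submodule.mem_sup.1 hv
    rw [map_add]
    exact Submodule.add_mem_sup (hb x hx w hw) (hb' x hx w' hw')
  | mul_X q t h =>
    obtain ⟨W, hq, hW, hb⟩ := h
    obtain ⟨⟨p, c, i⟩, hc, hi⟩ := t
    dsimp only at hc hi
    have hfin := M.finite_coordSpan p c i
    refine ⟨W * coordSpan K p c i, Submodule.mul_mem_mul hq (Submodule.subset_span (Or.inr
      ⟨c, ⟨le_rfl, hc.trans hi.le⟩, i, ⟨hc.trans hi.le, le_rfl⟩, hi,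
        (coordG_of_mem hc hi).symm⟩)), ?_, fun x hx v hv => ?_⟩
    · exact Module.Finite.iff_fg.2 (Submodule.FG.mul (Module.Finite.iff_fg.1 hW)
        (Module.Finite.iff_fg.1 hfin))
    · refine Submodule.mul_induction_on hv (fun w hw z hz => ?_) fun v v' h h' => ?_
      · rw [polyRep_apply, Derivation.leibniz, smul_eq_mul, smul_eq_mul, mul_comm z]
        refine add_mem (Submodule.mul_mem_mul hw ?_) (Submodule.mul_mem_mul (hb x hx w hw) hz)
        refine M.apply_mem_of_mem_b ((LinearMap.applyₗ z).comp (M.polyRep : g →ₗ[K] _))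
          (coordSpan K p c i) (fun a b hab => ?_) hx
        change M.polyRep (M.E (a, b)) z ∈ _
        rw [polyRep_E]
        exact neg_mem (coordD_mem_coordSpan hab hz)
      · rw [map_add]
        exact add_mem h h'

lemma coordD_self_coordG {p c i : X} (hc : c ≤ p) (hi : p < i) (b : X) :
    coordD K b b (coordG K p c i) =
      ((if c = b then 1 else 0) - if b = i then 1 else 0 : K) • coordG K p c i := by
  rw [coordD_coordG _ _ _ hi]
  rcases lt_or_ge p b with hb | hb
  · rw [coordH_of_le_of_lt hc hb, coordG_of_lt hb, if_neg (hc.trans_lt hb).ne]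
    split_ifs with h
    · subst h; simp
    · simp
  · rw [coordH_of_le hb, if_neg (hb.trans_lt hi).ne]
    split_ifs with h
    · subst h; simp
    · simp

lemma polyMod_inO : S.InO (RepMod M.polyRep) := by
  constructor
  · intro q
    change MvPolynomial (CoordIndex X) K at q
    change RepMod.of M.polyRep q ∈ _
    induction q using MvPolynomial.induction_on with
    | C c =>
      refine AddSubgroup.subset_closure (Set.mem_iUnion.2 ⟨0, mem_wtSet_iff.2 fun H => ?_⟩)
      rw [RepMod.ι_smul, polyRep_apply, MvPolynomial.C_eq_smul_one, Derivation.map_smul,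
        Derivation.map_one_eq_zero, smul_zero, map_zero, LinearMap.zero_apply, zero_smul]
    | add q q' h h' => rw [map_add]; exact add_mem h h'
    | mul_X q t h =>
      obtain ⟨⟨p, c, i⟩, hc, hi⟩ := t
      dsimp only at hc hi
      rw [← coordG_of_mem hc hi]
      obtain ⟨χ, hχ⟩ := M.exists_weight
        ((LinearMap.applyₗ (coordG K p c i)).comp (M.polyRep : g →ₗ[K] _)) (coordG K p c i) _
        fun b => by
          change M.polyRep (M.E (b, b)) (coordG K p c i) = _
          rw [polyRep_E, coordD_self_coordG hc hi, ← neg_smul]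
      have key : ∀ z ∈ AddSubgroup.closure (⋃ χ, S.wtSet (RepMod M.polyRep) χ),
          RepMod.of M.polyRep ((RepMod.of M.polyRep).symm z * coordG K p c i) ∈
            AddSubgroup.closure (⋃ χ, S.wtSet (RepMod M.polyRep) χ) := by
        intro z hz
        induction hz using AddSubgroup.closure_induction with
        | mem z hz =>
          obtain ⟨ψ, hψ⟩ := Set.mem_iUnion.1 hz
          refine AddSubgroup.subset_closure
            (Set.mem_iUnion.2 ⟨ψ + χ, mem_wtSet_iff.2 fun H => ?_⟩)
          have h1 := mem_wtSet_iff.1 hψ H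
          obtain ⟨z, rfl⟩ := (RepMod.of M.polyRep).surjective z
          rw [RepMod.ι_smul, ← map_smul, polyRep_apply] at h1
          have h1 := (RepMod.of M.polyRep).injective h1
          have h2 : M.polyDer (H : g) (coordG K p c i) = χ H • coordG K p c i := hχ H
          rw [LinearEquiv.symm_apply_apply, RepMod.ι_smul, ← map_smul, polyRep_apply,
            Derivation.leibniz, h1, h2, LinearMap.add_apply, add_smul]
          congr 1
          rw [smul_eq_mul, smul_eq_mul, mul_smul_comm, mul_smul_comm, add_comm,
            mul_comm (coordG K p c i)]
        | zero => rw [map_zero, zero_mul, map_zero]; exact zero_mem _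
        | add z z' _ _ h h' => rw [map_add, add_mul, map_add]; exact add_mem h h'
        | neg z _ h => rw [map_neg, neg_mul, map_neg]; exact neg_mem h
      have := key _ h
      rwa [LinearEquiv.symm_apply_apply] at this
  · refine (isLocFin_iff S).2 (RepMod.forall _ fun q => ?_)
    obtain ⟨W, hq, hW, hb⟩ := M.exists_finite_stable q
    refine ⟨W.map (RepMod.of M.polyRep).toLinearMap, ⟨q, hq, rfl⟩, inferInstance, ?_⟩
    rintro x hx _ ⟨v, hv, rfl⟩
    exact ⟨M.polyRep x v, hb x hx v hv, (RepMod.ι_smul _ _ _).symm⟩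

end MatrixUnits

variable (K) in
/-- The underlying vector space of the trivial module. -/
def trivOf : K ≃ₗ[K] TrivMod K := LinearEquiv.refl K K

lemma uea_smul_trivOf (u : UEA K g) (v : K) :
    u • trivOf K v = trivOf K (lift K (0 : g →ₗ⁅K⁆ K) u * v) := rfl

instance : IsScalarTower K (UEA K g) (TrivMod K) where
  smul_assoc c u v := by
    obtain ⟨v, rfl⟩ := (trivOf K).surjective v
    rw [uea_smul_trivOf, uea_smul_trivOf, map_smul, smul_eq_mul, mul_assoc, ← smul_eq_mul, map_smul]

lemma ι_smul_trivMod (x : g) (v : TrivMod K) : ι K x • v = 0 := by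
  obtain ⟨v, rfl⟩ := (trivOf K).surjective v
  rw [uea_smul_trivOf, lift_ι_apply, LieHom.zero_apply, zero_mul, map_zero]

section Quotients

variable {R T A W B : Type} [Ring R] [AddCommGroup T] [Module R T] [AddCommGroup A] [Module R A]
  [AddCommGroup W] [Module R W] [AddCommGroup B] [Module R B]

/-- The inclusion `A / T → W / T` induced by a map `A → W`. -/
def quotRangeMap (t : T →ₗ[R] A) (j : A →ₗ[R] W) :
    A ⧸ LinearMap.range t →ₗ[R] W ⧸ LinearMap.range (j ∘ₗ t) :=
  Submodule.mapQ _ _ j (by rintro _ ⟨x, rfl⟩; exact ⟨x, rfl⟩)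

lemma quotRangeMap_injective (t : T →ₗ[R] A) {j : A →ₗ[R] W} (hj : Function.Injective j) :
    Function.Injective (quotRangeMap t j) := by
  refine (injective_iff_map_eq_zero _).2 fun a ha => ?_
  obtain ⟨a, rfl⟩ := Submodule.mkQ_surjective _ a
  rw [quotRangeMap, Submodule.mkQ_apply, Submodule.mapQ_apply, Submodule.Quotient.mk_eq_zero] at ha
  obtain ⟨x, hx⟩ := ha
  exact (Submodule.Quotient.mk_eq_zero _).2 ⟨x, hj hx⟩

/-- The projection `W / T → B` induced by a map `W → B`. -/
def quotRangeProj (t : T →ₗ[R] A) {j : A →ₗ[R] W} {q : W →ₗ[R] B} (h : Function.Exact j q) :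
    W ⧸ LinearMap.range (j ∘ₗ t) →ₗ[R] B :=
  Submodule.liftQ _ q (by rintro _ ⟨x, rfl⟩; exact (h _).2 ⟨t x, rfl⟩)

lemma quotRangeProj_surjective (t : T →ₗ[R] A) {j : A →ₗ[R] W} {q : W →ₗ[R] B}
    (h : Function.Exact j q) (hq : Function.Surjective q) :
    Function.Surjective (quotRangeProj t h) := fun b => by
  obtain ⟨w, rfl⟩ := hq b
  exact ⟨Submodule.Quotient.mk w, rfl⟩

lemma exact_quotRangeMap_quotRangeProj (t : T →ₗ[R] A) {j : A →ₗ[R] W} {q : W →ₗ[R] B}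
    (h : Function.Exact j q) :
    Function.Exact (quotRangeMap t j) (quotRangeProj t h) := by
  intro w
  obtain ⟨w, rfl⟩ := Submodule.mkQ_surjective _ w
  constructor
  · intro hw
    obtain ⟨a, rfl⟩ := (h w).1 hw
    exact ⟨Submodule.Quotient.mk a, rfl⟩
  · rintro ⟨a, ha⟩
    obtain ⟨a, rfl⟩ := Submodule.mkQ_surjective _ a
    rw [← ha]
    exact (h _).2 ⟨a, rfl⟩

end Quotients

namespace MatrixUnits

variable {S : RootReductive K g} {X : Type} [LinearOrder X] (M : MatrixUnits S X)

lemma polyRep_C (x : g) (c : K) : M.polyRep x (MvPolynomial.C c) = 0 := by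
  rw [polyRep_apply, MvPolynomial.C_eq_smul_one, Derivation.map_smul, Derivation.map_one_eq_zero,
    smul_zero]

/-- The inclusion of the constants into the polynomials. -/
def constHom : TrivMod K →ₗ[UEA K g] RepMod M.polyRep :=
  ueaLinearMap ((RepMod.of M.polyRep).toLinearMap ∘ₗ
      Algebra.linearMap K (MvPolynomial (CoordIndex X) K) ∘ₗ (trivOf K).symm.toLinearMap)
    fun x m => by
      rw [ι_smul_trivMod, map_zero]
      change 0 = ι K x • RepMod.of M.polyRep (MvPolynomial.C ((trivOf K).symm m))
      rw [RepMod.ι_smul, polyRep_C, map_zero]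

lemma constHom_trivOf (c : K) :
    M.constHom (trivOf K c) = RepMod.of M.polyRep (MvPolynomial.C c) := rfl

lemma constHom_injective : Function.Injective M.constHom := fun _ _ h =>
  (trivOf K).symm.injective (MvPolynomial.C_injective _ _ ((RepMod.of M.polyRep).injective h))

/-- The inclusion of polynomials into the extension of cocycles by polynomials. -/
def polyHom : RepMod M.polyRep →ₗ[UEA K g] RepMod M.cocycleRep :=
  ueaLinearMap ((RepMod.of M.cocycleRep).toLinearMap ∘ₗ LinearMap.inl K _ _ ∘ₗ
      (RepMod.of M.polyRep).symm.toLinearMap) fun x => RepMod.forall _ fun q => by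
    rw [RepMod.ι_smul]
    exact (congrArg _ (M.cocycleRep_inl x q).symm).trans (RepMod.ι_smul M.cocycleRep x (q, 0)).symm

lemma polyHom_of (q : MvPolynomial (CoordIndex X) K) :
    M.polyHom (RepMod.of M.polyRep q) = RepMod.of M.cocycleRep (q, 0) := rfl

/-- The space of cocycles, with the trivial action. -/
abbrev CocycleMod (_ : MatrixUnits S X) : Type :=
  RepMod (0 : g →ₗ⁅K⁆ Module.End K (CocycleIndex X →₀ K))

/-- The underlying vector space of `CocycleMod`. -/
abbrev cocycleOf : (CocycleIndex X →₀ K) ≃ₗ[K] M.CocycleMod := RepMod.of _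

lemma ι_smul_cocycleMod (x : g) (v : M.CocycleMod) : ι K x • v = 0 := by
  obtain ⟨v, rfl⟩ := M.cocycleOf.surjective v
  rw [RepMod.ι_smul, LieHom.zero_apply, LinearMap.zero_apply, map_zero]

/-- The projection onto the space of cocycles. -/
def cocycleHom : RepMod M.cocycleRep →ₗ[UEA K g] M.CocycleMod :=
  ueaLinearMap (M.cocycleOf.toLinearMap ∘ₗ LinearMap.snd K _ _ ∘ₗ
      (RepMod.of M.cocycleRep).symm.toLinearMap) fun x => RepMod.forall _ fun w => by
    rw [RepMod.ι_smul, ι_smul_cocycleMod]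
    exact M.snd_cocycleRep x w

lemma polyHom_injective : Function.Injective M.polyHom := fun _ _ h =>
  congrArg Prod.fst ((RepMod.of M.cocycleRep).injective h)

lemma cocycleHom_surjective : Function.Surjective M.cocycleHom := fun f =>
  ⟨RepMod.of M.cocycleRep (0, f), rfl⟩

lemma exact_polyHom_cocycleHom : Function.Exact M.polyHom M.cocycleHom := by
  refine RepMod.forall _ fun w => ⟨fun hw => ⟨RepMod.of M.polyRep w.1, ?_⟩, ?_⟩
  · rw [polyHom_of]
    exact congrArg _ (Prod.ext rfl (Eq.symm hw))
  · rintro ⟨q, hq⟩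
    rw [← hq]
    rfl

/-- The cocycles take constant values on `b`. -/
lemma cocycleRep_mem_of_mem_b {x : g} (hx : x ∈ S.b) (f : CocycleIndex X →₀ K) :
    M.cocycleRep x (0, f) ∈
      LinearMap.range (LinearMap.inl K (MvPolynomial (CoordIndex X) K) (CocycleIndex X →₀ K) ∘ₗ
        Algebra.linearMap K _) := by
  refine M.apply_mem_of_mem_b ((LinearMap.applyₗ (0, f)).comp
    (M.cocycleRep : g →ₗ[K] Module.End K (MvPolynomial (CoordIndex X) K × (CocycleIndex X →₀ K)))) _
    (fun a b hab => ?_) hx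
  change M.cocycleRep (M.E (a, b)) (0, f) ∈ _
  rw [cocycleRep_E]
  induction f using Finsupp.induction_linear with
  | zero => exact (map_zero (cocycleEnd K a b)).symm ▸ zero_mem _
  | add f f' h h' =>
    have e : ((0, f + f') : MvPolynomial (CoordIndex X) K × (CocycleIndex X →₀ K)) =
      (0, f) + (0, f') := by rw [Prod.mk_add_mk, add_zero]
    rw [e, map_add]
    exact add_mem h h'
  | single p c =>
    have e : ((0, Finsupp.single p c) : MvPolynomial (CoordIndex X) K × (CocycleIndex X →₀ K)) =
      c • (0, Finsupp.single p 1) := by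
      rw [Prod.smul_mk, smul_zero, Finsupp.smul_single, smul_eq_mul, mul_one]
    rw [e, map_smul, cocycleEnd_single]
    refine Submodule.smul_mem _ _ ?_
    rw [coordCocycle]
    split_ifs with h
    · rw [coordG_of_lt (h.trans_le hab)]
      split_ifs
      · exact ⟨1, by simp⟩
      · exact zero_mem _
    · exact zero_mem _

variable {T : Type} [AddCommGroup T] [Module (UEA K g) T] (e : T ≃ₗ[UEA K g] TrivMod K)

/-- The inclusion of a trivial module as the constants. -/
def trivHom : T →ₗ[UEA K g] RepMod M.polyRep := M.constHom ∘ₗ e.toLinearMap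

lemma trivHom_injective : Function.Injective (M.trivHom e) :=
  M.constHom_injective.comp e.injective

lemma quotPoly_inO : S.InO (RepMod M.polyRep ⧸ LinearMap.range (M.trivHom e)) :=
  inO_of_surjective M.polyMod_inO _ (Submodule.mkQ_surjective _)

lemma cocycleMod_inO : S.InO M.CocycleMod :=
  inO_of_forall_exists_add M.polyMod_inO 0 fun v =>
    ⟨0, v, by rw [map_zero, zero_add], fun x _ => M.ι_smul_cocycleMod x v⟩

lemma mk_eq_zero_of_const (c : K) :
    (Submodule.Quotient.mk (RepMod.of M.cocycleRep (MvPolynomial.C c, 0)) :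
      RepMod M.cocycleRep ⧸ LinearMap.range (M.polyHom ∘ₗ M.trivHom e)) = 0 :=
  (Submodule.Quotient.mk_eq_zero _).2 ⟨e.symm (trivOf K c), by
    change M.polyHom (M.constHom (e (e.symm (trivOf K c)))) = _
    rw [e.apply_symm_apply]
    rfl⟩

lemma quotCocycle_inO :
    S.InO (RepMod M.cocycleRep ⧸ LinearMap.range (M.polyHom ∘ₗ M.trivHom e)) :=
  inO_of_forall_exists_add M.polyMod_inO (Submodule.mkQ _ ∘ₗ M.polyHom) fun w => by
    obtain ⟨w, rfl⟩ := Submodule.mkQ_surjective _ w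
    obtain ⟨w, rfl⟩ := (RepMod.of M.cocycleRep).surjective w
    refine ⟨RepMod.of M.polyRep w.1, Submodule.mkQ _ (RepMod.of M.cocycleRep (0, w.2)), ?_,
      fun x hx => ?_⟩
    · rw [LinearMap.comp_apply, polyHom_of, ← map_add, ← map_add, Prod.mk_add_mk, add_zero,
        zero_add]
    · rw [← map_smul, RepMod.ι_smul]
      obtain ⟨c, hc⟩ := M.cocycleRep_mem_of_mem_b hx w.2
      rw [← hc]
      exact M.mk_eq_zero_of_const e c

end MatrixUnits

lemma constantCoeff_coordD_self {X : Type} [LinearOrder X] (b : X)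
    (q : MvPolynomial (CoordIndex X) K) :
    MvPolynomial.constantCoeff (coordD K b b q) = 0 := by
  induction q using MvPolynomial.induction_on with
  | C c =>
    rw [MvPolynomial.C_eq_smul_one, Derivation.map_smul, Derivation.map_one_eq_zero, smul_zero,
      map_zero]
  | add q q' h h' => rw [map_add, map_add, h, h', add_zero]
  | mul_X q t h =>
    obtain ⟨⟨p, c, i⟩, hc, hi⟩ := t
    dsimp only at hc hi
    have h0 : MvPolynomial.constantCoeff (coordG K p c i) = 0 := by
      rw [coordG_of_mem hc hi, MvPolynomial.constantCoeff_X]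
    rw [← coordG_of_mem hc hi, Derivation.leibniz, MatrixUnits.coordD_self_coordG hc hi,
      smul_eq_mul, smul_eq_mul, mul_smul_comm, map_add, MvPolynomial.constantCoeff_smul, map_mul,
      map_mul, h0, mul_zero, smul_zero, zero_mul, add_zero]

lemma constantCoeff_cocycleEnd_self {X : Type} [LinearOrder X] (b : X)
    (q : MvPolynomial (CoordIndex X) K) (f : CocycleIndex X →₀ K) :
    MvPolynomial.constantCoeff (cocycleEnd K b b (q, f)).1 =
      f.sum fun p c => if p.1 < b then c else 0 := by
  have h : (cocycleEnd K b b (q, f)).1 =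
      - coordD K b b q + f.sum fun p c => c • coordCocycle K p.1 b b := rfl
  rw [h, map_add, map_neg, constantCoeff_coordD_self, neg_zero, zero_add, Finsupp.sum, map_sum,
    Finsupp.sum]
  refine Finset.sum_congr rfl fun p _ => ?_
  rw [MvPolynomial.constantCoeff_smul, coordCocycle]
  split_ifs with hp
  · rw [coordG_of_lt hp, if_pos rfl, map_one, smul_eq_mul, mul_one]
  · rw [map_zero, smul_zero]

/-- A finitely supported function is determined by its sums over initial segments. -/
lemma eq_zero_of_sum_lt_eq {X : Type} [LinearOrder X] {f : CocycleIndex X →₀ K}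
    (h : ∀ b b' : X, (f.sum fun p c => if p.1 < b then c else 0) =
      f.sum fun p c => if p.1 < b' then c else 0) : f = 0 := by
  by_contra hf
  have hs := Finsupp.support_nonempty_iff.2 hf
  set m := f.support.max' hs
  have hm : m ∈ f.support := Finset.max'_mem _ _
  obtain ⟨b, hb⟩ := not_isMax_iff.1 m.2
  have h' := sub_eq_zero.2 (h b m.1)
  rw [Finsupp.sum, Finsupp.sum, ← Finset.sum_sub_distrib, Finset.sum_eq_single m, if_pos hb,
    if_neg (lt_irrefl _), sub_zero] at h'
  · exact Finsupp.mem_support_iff.1 hm h'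
  · intro p hp hpm
    have hlt : p.1 < m.1 := lt_of_le_of_ne (f.support.le_max' p hp) fun e => hpm (Subtype.ext e)
    rw [if_pos (hlt.trans hb), if_pos hlt, sub_self]
  · exact fun h => absurd hm h

/-- A weight module surjecting onto the trivial module contains a vector of weight zero over
each scalar. -/
lemma exists_weight_zero_lift {S : RootReductive K g} {P : Type} [AddCommGroup P]
    [Module (UEA K g) P] (hP : S.IsWeightMod P) (p : P →ₗ[UEA K g] TrivMod K)
    (hp : Function.Surjective p) :
    ∃ u, p u = trivOf K 1 ∧ ∀ x ∈ S.h, ι K x • u = 0 := by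
  let _ : Module K P := Module.compHom P (algebraMap K (UEA K g))
  have : IsScalarTower K (UEA K g) P := ⟨fun c u m => by
    rw [Algebra.smul_def, mul_smul]; rfl⟩
  obtain ⟨m, hm⟩ := hp (trivOf K 1)
  obtain ⟨F, hF, rfl⟩ := exists_weight_components hP m
  obtain ⟨χ, hχ⟩ : ∃ χ, p (F χ) ≠ 0 := by
    by_contra! h
    rw [Finsupp.sum, map_sum, Finset.sum_eq_zero fun χ _ => h χ] at hm
    exact one_ne_zero ((trivOf K).map_eq_zero_iff.1 hm.symm)
  have hχ0 (H : S.h) : χ H = 0 := by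
    have h := congrArg p (mem_wtSet_iff.1 (hF χ) H)
    rw [map_smul, ι_smul_trivMod] at h
    have h' : p (χ H • F χ) = χ H • p (F χ) := (p.restrictScalars K).map_smul _ _
    rw [h'] at h
    exact (smul_eq_zero.1 h.symm).resolve_right hχ
  obtain ⟨c, hc⟩ := (trivOf K).surjective (p (F χ))
  have hc0 : c ≠ 0 := by
    rintro rfl
    exact hχ (hc.symm.trans (map_zero _))
  refine ⟨c⁻¹ • F χ, ?_, fun x hx => ?_⟩
  · have h' : p (c⁻¹ • F χ) = c⁻¹ • p (F χ) := (p.restrictScalars K).map_smul _ _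
    rw [h', ← hc, ← map_smul, smul_eq_mul, inv_mul_cancel₀ hc0]
  · rw [smul_comm, mem_wtSet_iff.1 (hF χ) ⟨x, hx⟩, hχ0, zero_smul, smul_zero]

namespace MatrixUnits

variable {S : RootReductive K g} {X : Type} [LinearOrder X] (M : MatrixUnits S X)

lemma eq_zero_of_cocycleRep_lie_eq_zero (q : MvPolynomial (CoordIndex X) K)
    (f : CocycleIndex X →₀ K)
    (h : ∀ x y : g, ⁅x, y⁆ ∈ S.h → M.cocycleRep ⁅x, y⁆ (q, f) = 0) : f = 0 := by
  refine eq_zero_of_sum_lt_eq fun b b' => ?_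
  have hl : ⁅M.E (b, b'), M.E (b', b)⁆ = M.E (b, b) - M.E (b', b') := by
    rw [M.lie_E]
    simp
  have h' := h (M.E (b, b')) (M.E (b', b)) (hl ▸ sub_mem (M.diag_mem b) (M.diag_mem b'))
  rw [hl, map_sub, LinearMap.sub_apply, cocycleRep_E, cocycleRep_E, sub_eq_zero] at h'
  rw [← constantCoeff_cocycleEnd_self b q, ← constantCoeff_cocycleEnd_self b' q, h']

variable {T : Type} [AddCommGroup T] [Module (UEA K g) T] (e : T ≃ₗ[UEA K g] TrivMod K)

lemma exists_of_mk_eq {w : MvPolynomial (CoordIndex X) K × (CocycleIndex X →₀ K)}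
    {r : MvPolynomial (CoordIndex X) K}
    (h : (Submodule.Quotient.mk (RepMod.of M.cocycleRep w) :
      RepMod M.cocycleRep ⧸ LinearMap.range (M.polyHom ∘ₗ M.trivHom e)) =
      Submodule.Quotient.mk (M.polyHom (RepMod.of M.polyRep r))) :
    ∃ c : K, w = (r + MvPolynomial.C c, 0) := by
  obtain ⟨t, ht⟩ := (Submodule.Quotient.eq _).1 h
  obtain ⟨c, hc⟩ := (trivOf K).surjective (e t)
  refine ⟨c, ?_⟩
  rw [LinearMap.comp_apply, trivHom, LinearMap.comp_apply, LinearEquiv.coe_coe, ← hc,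
    constHom_trivOf, polyHom_of, polyHom_of, ← map_sub] at ht
  have h' := (RepMod.of M.cocycleRep).injective ht
  rw [← sub_add_cancel w (r, 0), ← h', Prod.mk_add_mk, add_zero, add_comm]

/-- The connecting morphism of a nonzero linear combination of cocycles does not vanish after
pulling back to any module in category `O`. -/
lemma eq_zero_of_lift {N P : Type} [AddCommGroup N] [Module (UEA K g) N] [AddCommGroup P]
    [Module (UEA K g) P] (hP : S.IsWeightMod P) {i : N →ₗ[UEA K g] P}
    {p : P →ₗ[UEA K g] TrivMod K} (hi : Function.Injective i) (hp : Function.Surjective p)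
    (hip : Function.Exact i p) (d : N →ₗ[UEA K g] RepMod M.polyRep)
    (s : P →ₗ[UEA K g] RepMod M.cocycleRep ⧸ LinearMap.range (M.polyHom ∘ₗ M.trivHom e))
    (f : CocycleIndex X →₀ K)
    (hs : ∀ u, quotRangeProj (M.trivHom e) M.exact_polyHom_cocycleHom (s u) =
      M.cocycleOf ((trivOf K).symm (p u) • f))
    (hd : ∀ n, s (i n) = Submodule.Quotient.mk (M.polyHom (d n))) : f = 0 := by
  obtain ⟨u, hu, hu0⟩ := exists_weight_zero_lift hP p hp
  obtain ⟨w, hw⟩ := Submodule.mkQ_surjective _ (s u)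
  obtain ⟨⟨q, f'⟩, rfl⟩ := (RepMod.of M.cocycleRep).surjective w
  obtain rfl : f' = f := by
    have h := hs u
    rw [← hw, hu, LinearEquiv.symm_apply_apply, one_smul] at h
    exact M.cocycleOf.injective h
  have hn (x : g) : ∃ n, i n = ι K x • u :=
    (hip _).1 (by rw [map_smul, ι_smul_trivMod])
  choose n hn using hn
  choose r hr using fun x => (RepMod.of M.polyRep).surjective (d (n x))
  have hc (x : g) : ∃ c, M.cocycleRep x (q, f') = (r x + MvPolynomial.C c, 0) := by
    refine M.exists_of_mk_eq e ?_
    rw [hr, ← hd, hn, map_smul, ← hw, ← map_smul, RepMod.ι_smul]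
    rfl
  choose c hc using hc
  refine M.eq_zero_of_cocycleRep_lie_eq_zero q f' fun x y hxy => ?_
  have hrxy : M.polyRep x (r y) = M.polyRep y (r x) := by
    refine (RepMod.of M.polyRep).injective ?_
    rw [← RepMod.ι_smul, ← RepMod.ι_smul, hr, hr, ← map_smul, ← map_smul]
    congr 1
    refine hi ?_
    rw [map_smul, map_smul, hn, hn, ← sub_eq_zero, smul_smul, smul_smul, ← sub_smul]
    have hl : ι K ⁅x, y⁆ = ι K x * ι K y - ι K y * ι K x := (ι K).map_lie x y
    rw [← hl]
    exact hu0 _ hxy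
  have hl : M.cocycleRep ⁅x, y⁆ =
      M.cocycleRep x * M.cocycleRep y - M.cocycleRep y * M.cocycleRep x :=
    M.cocycleRep.map_lie x y
  rw [hl, LinearMap.sub_apply, Module.End.mul_apply, Module.End.mul_apply, hc, hc, cocycleRep_inl,
    cocycleRep_inl, map_add, map_add, polyRep_C, polyRep_C, hrxy, sub_self]

end MatrixUnits

/-- A fully faithful functor from an abelian category to a preadditive category is additive. -/
lemma additive_of_full_of_faithful {C D : Type*} [Category* C] [Category* D] [Abelian C]
    [Preadditive D] (F : C ⥤ D) [F.Full] [F.Faithful] : F.Additive := by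
  have h := (Functor.FullyFaithful.ofFullyFaithful F).additive_ofFullyFaithful
  have e : Preadditive.ofFullyFaithful (Functor.FullyFaithful.ofFullyFaithful F) =
      (inferInstance : Preadditive C) := Subsingleton.elim _ _
  rwa [e] at h

section ConcreteExact

variable {C : Type 1} [Category.{0} C] [Abelian C] {R : Type} [Ring R]
  (F : C ⥤ ModuleCat.{0} R) [F.Full] [F.Faithful]

lemma exists_shortExact_of_exact {X Y Z : C} (f : X ⟶ Y) (g : Y ⟶ Z)
    (hf : Function.Injective (F.map f)) (hg : Function.Surjective (F.map g))
    (h : Function.Exact (F.map f) (F.map g)) :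
    ∃ w : f ≫ g = 0, (ShortComplex.mk f g w).ShortExact := by
  have := additive_of_full_of_faithful F
  have := F.reflectsMonomorphisms_of_faithful
  have := F.reflectsEpimorphisms_of_faithful
  have w' : F.map f ≫ F.map g = 0 := by
    ext x
    exact (h _).2 ⟨x, rfl⟩
  have w : f ≫ g = 0 := F.map_injective (by rw [F.map_comp, w', F.map_zero])
  have hm : Mono f := F.mono_of_mono_map ((ModuleCat.mono_iff_injective _).2 hf)
  have he : Epi g := F.epi_of_epi_map ((ModuleCat.epi_iff_surjective _).2 hg)
  have hS : (ShortComplex.mk (F.map f) (F.map g) w').ShortExact :=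
    ModuleCat.shortComplex_shortExact _ h hf hg
  refine ⟨w, ⟨ShortComplex.exact_of_f_is_kernel _
    (Limits.KernelFork.IsLimit.ofι' f w fun {A} k hk => ?_)⟩⟩
  have hk' : F.map k ≫ F.map g = 0 := by rw [← F.map_comp, hk, F.map_zero]
  have := hS.mono_f
  refine ⟨F.preimage (hS.exact.lift (F.map k) hk'), F.map_injective ?_⟩
  rw [F.map_comp, F.map_preimage]
  exact hS.exact.lift_f _ _

variable (hker : ∀ {X Y : C} (f : X ⟶ Y), ∃ (Z : C) (k : Z ⟶ X),
    LinearMap.range (F.map k).hom = LinearMap.ker (F.map f).hom)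
  (hcoker : ∀ {X Y : C} (f : X ⟶ Y), ∃ (Z : C) (k : Y ⟶ Z),
    Function.Surjective (F.map k) ∧ LinearMap.ker (F.map k).hom = LinearMap.range (F.map f).hom)

include hker in
lemma injective_of_mono {X Y : C} (f : X ⟶ Y) [Mono f] : Function.Injective (F.map f) := by
  have := additive_of_full_of_faithful F
  obtain ⟨Z, k, hk⟩ := hker f
  have h : F.map k ≫ F.map f = 0 := by
    ext z
    exact (hk ▸ LinearMap.mem_range_self (F.map k).hom z :)
  have hk0 : k = 0 := by
    rw [← cancel_mono f, Limits.zero_comp]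
    exact F.map_injective (by rw [F.map_comp, h, F.map_zero])
  refine (LinearMap.ker_eq_bot (f := (F.map f).hom)).1 ?_
  rw [← hk, hk0, F.map_zero]
  exact LinearMap.range_zero

include hcoker in
lemma surjective_of_epi {X Y : C} (f : X ⟶ Y) [Epi f] : Function.Surjective (F.map f) := by
  have := additive_of_full_of_faithful F
  obtain ⟨Z, k, -, hk⟩ := hcoker f
  have h : F.map f ≫ F.map k = 0 := by
    ext z
    exact (hk.symm ▸ LinearMap.mem_range_self (F.map f).hom z :)
  have hk0 : k = 0 := by
    rw [← cancel_epi f, Limits.comp_zero]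
    exact F.map_injective (by rw [F.map_comp, h, F.map_zero])
  refine (LinearMap.range_eq_top (f := (F.map f).hom)).1 ?_
  rw [← hk, hk0, F.map_zero]
  exact LinearMap.ker_zero

include hcoker in
lemma exact_of_shortExact {S : ShortComplex C} (hS : S.ShortExact) :
    Function.Exact (F.map S.f) (F.map S.g) := by
  have := additive_of_full_of_faithful F
  have := hS.epi_g
  intro y
  constructor
  · intro hy
    obtain ⟨Z, k, -, hk⟩ := hcoker S.f
    have h : S.f ≫ k = 0 := F.map_injective <| by
      rw [F.map_comp, F.map_zero]
      ext z
      exact (hk.symm ▸ LinearMap.mem_range_self (F.map S.f).hom z :)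
    have hy' : y ∈ LinearMap.ker (F.map k).hom := by
      rw [← hS.exact.g_desc k h, F.map_comp]
      change F.map (hS.exact.desc k h) (F.map S.g y) = 0
      rw [hy, map_zero]
    rwa [hk] at hy'
  · rintro ⟨x, rfl⟩
    change (F.map S.f ≫ F.map S.g) x = 0
    rw [← F.map_comp, S.zero, F.map_zero]
    rfl

end ConcreteExact

section Scalars

variable {C : Type 1} [Category.{0} C] [Abelian C] {R : Type} [Ring R] [Algebra K R]
  (F : C ⥤ ModuleCat.{0} R) [F.Full] [F.Faithful]

variable (K) in
/-- The endomorphism by which a scalar acts. -/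
def scalarHom (X : C) (c : K) : X ⟶ X :=
  F.preimage (ModuleCat.ofHom
    { toFun m := algebraMap K R c • m
      map_add' := smul_add _
      map_smul' r m := by rw [RingHom.id_apply, smul_smul, smul_smul, Algebra.commutes] })

lemma map_scalarHom (X : C) (c : K) (x : F.obj X) :
    F.map (scalarHom K F X c) x = algebraMap K R c • x := by
  rw [scalarHom, F.map_preimage]
  rfl

lemma scalarHom_naturality {X Y : C} (f : X ⟶ Y) (c : K) :
    scalarHom K F X c ≫ f = f ≫ scalarHom K F Y c := F.map_injective <| by
  ext x
  rw [F.map_comp, F.map_comp, ModuleCat.comp_apply, ModuleCat.comp_apply, map_scalarHom,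
    map_scalarHom, map_smul]

variable (K) in
/-- Scalars as a ring homomorphism into endomorphisms. -/
def scalarEnd (X : C) : K →+* End X where
  toFun := scalarHom K F X
  map_one' := F.map_injective <| by
    ext x
    rw [map_scalarHom, map_one, one_smul]
    exact (congrArg (fun h : F.obj X ⟶ F.obj X => h x) (F.map_id X)).symm
  map_mul' c d := F.map_injective <| by
    ext x
    change _ = F.map (scalarHom K F X d ≫ scalarHom K F X c) x
    rw [F.map_comp, ModuleCat.comp_apply, map_scalarHom, map_scalarHom, map_scalarHom, map_mul,
      mul_smul]
  map_zero' := F.map_injective <| by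
    have := additive_of_full_of_faithful F
    ext x
    rw [map_scalarHom, map_zero, zero_smul]
    exact (congrArg (fun h : F.obj X ⟶ F.obj X => h x) (F.map_zero X X)).symm
  map_add' c d := F.map_injective <| by
    have := additive_of_full_of_faithful F
    ext x
    rw [F.map_add, map_scalarHom, map_add, add_smul]
    exact congrArg₂ _ (map_scalarHom F X c x).symm (map_scalarHom F X d x).symm

variable [HasExt.{1} C]

variable (K) in
/-- Scalars acting on extensions. -/
def scalarExt (X Y : C) (n : ℕ) : K →+* AddMonoid.End (Abelian.Ext X Y n) where
  toFun c := (Abelian.Ext.mk₀ (scalarHom K F Y c)).postcomp X (add_zero n)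
  map_one' := by
    ext x
    change x.comp (Abelian.Ext.mk₀ (scalarEnd K F Y 1)) (add_zero n) = x
    rw [map_one]
    exact x.comp_mk₀_id
  map_mul' c d := by
    ext x
    change x.comp (Abelian.Ext.mk₀ (scalarEnd K F Y (c * d))) (add_zero n) =
      (x.comp (Abelian.Ext.mk₀ (scalarEnd K F Y d)) (add_zero n)).comp
        (Abelian.Ext.mk₀ (scalarEnd K F Y c)) (add_zero n)
    rw [map_mul, Abelian.Ext.comp_assoc_of_third_deg_zero, Abelian.Ext.mk₀_comp_mk₀]
    rfl
  map_zero' := by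
    ext x
    change x.comp (Abelian.Ext.mk₀ (scalarEnd K F Y 0)) (add_zero n) = 0
    rw [map_zero, Abelian.Ext.mk₀_zero, Abelian.Ext.comp_zero]
  map_add' c d := by
    ext x
    change x.comp (Abelian.Ext.mk₀ (scalarEnd K F Y (c + d))) (add_zero n) =
      x.comp (Abelian.Ext.mk₀ (scalarEnd K F Y c)) (add_zero n) +
        x.comp (Abelian.Ext.mk₀ (scalarEnd K F Y d)) (add_zero n)
    rw [map_add, Abelian.Ext.mk₀_add, Abelian.Ext.comp_add]

lemma scalarExt_apply (X Y : C) (n : ℕ) (c : K) (x : Abelian.Ext X Y n) :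
    scalarExt K F X Y n c x = x.comp (Abelian.Ext.mk₀ (scalarHom K F Y c)) (add_zero n) := rfl

lemma scalar_comp_extClass {S : ShortComplex C} (hS : S.ShortExact) (c : K) :
    hS.extClass.comp (Abelian.Ext.mk₀ (scalarHom K F S.X₁ c)) (add_zero 1) =
      (Abelian.Ext.mk₀ (scalarHom K F S.X₃ c)).comp hS.extClass (zero_add 1) :=
  ShortComplex.ShortExact.extClass_naturality hS hS
    { τ₁ := scalarHom K F S.X₁ c
      τ₂ := scalarHom K F S.X₂ c
      τ₃ := scalarHom K F S.X₃ c
      comm₁₂ := scalarHom_naturality F S.f c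
      comm₂₃ := scalarHom_naturality F S.g c }

omit [IsAlgClosed K] [CharZero K] in
lemma exists_ne_zero_map_eq_zero {V G : Type*} [AddCommGroup V] [Module K V] [AddCommGroup G]
    (act : K →+* AddMonoid.End G) (φ : V →+ G) (hφ : ∀ (c : K) v, φ (c • v) = act c (φ v))
    {n : ℕ} (gen : Fin n → G) (hgen : ∀ x, ∃ c : Fin n → K, x = ∑ i, act (c i) (gen i))
    (hV : ¬ FiniteDimensional K V) : ∃ v ≠ 0, φ v = 0 := by
  let _ : Module K G := Module.compHom G act
  let L : V →ₗ[K] G := { φ with map_smul' := hφ }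
  have hG : Module.Finite K G := by
    classical
    refine ⟨Finset.univ.image gen, ?_⟩
    refine eq_top_iff.2 fun x _ => ?_
    obtain ⟨c, rfl⟩ := hgen x
    refine sum_mem fun i _ => Submodule.smul_mem _ (c i) (Submodule.subset_span (by simp))
  by_contra! h
  exact hV (Module.Finite.of_injective L (LinearMap.ker_eq_bot.1 (LinearMap.ker_eq_bot'.2
    fun v hv => by_contra fun hv' => h v hv' hv)))

/-- If `Ext²(T, T)` is finite-dimensional, then some nonzero element of an infinite-dimensional
space of morphisms `T ⟶ B` has zero product with a given double extension of `B` by `T`. -/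
lemma exists_lift_of_span_ext_two {T A Q E B : C} {t : T ⟶ A} {π : A ⟶ Q} {f : Q ⟶ E} {q : E ⟶ B}
    {w₁ : t ≫ π = 0} {w₂ : f ≫ q = 0}
    (h₁ : (ShortComplex.mk t π w₁).ShortExact) (h₂ : (ShortComplex.mk f q w₂).ShortExact)
    {V : Type} [AddCommGroup V] [Module K V] (hV : ¬ FiniteDimensional K V)
    (j : V →+ (T ⟶ B)) (hj : ∀ (c : K) v, j (c • v) = j v ≫ scalarHom K F B c)
    {n : ℕ} (gen : Fin n → Abelian.Ext T T 2)
    (hgen : ∀ x, ∃ c : Fin n → K, x = ∑ i, scalarExt K F T T 2 (c i) (gen i)) :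
    ∃ v ≠ 0, ∃ (N P : C) (i : N ⟶ P) (p : P ⟶ T) (w : i ≫ p = 0)
      (_ : (ShortComplex.mk i p w).ShortExact) (g : N ⟶ A) (s : P ⟶ E),
      s ≫ q = p ≫ j v ∧ i ≫ s = g ≫ π ≫ f := by
  let ω : Abelian.Ext B T 2 := h₂.extClass.comp h₁.extClass (rfl : 1 + 1 = 2)
  let φ : V →+ Abelian.Ext T T 2 :=
    { toFun v := (Abelian.Ext.mk₀ (j v)).comp ω (zero_add 2)
      map_zero' := by rw [map_zero, Abelian.Ext.mk₀_zero, Abelian.Ext.zero_comp]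
      map_add' v v' := by rw [map_add, Abelian.Ext.mk₀_add, Abelian.Ext.add_comp] }
  have hω (c : K) : ω.comp (Abelian.Ext.mk₀ (scalarHom K F T c)) (add_zero 2) =
      (Abelian.Ext.mk₀ (scalarHom K F B c)).comp ω (zero_add 2) := by
    have e₁ := scalar_comp_extClass F h₁ c
    have e₂ := scalar_comp_extClass F h₂ c
    dsimp only at e₁ e₂
    rw [Abelian.Ext.comp_assoc_of_third_deg_zero, e₁,
      ← Abelian.Ext.comp_assoc_of_second_deg_zero, e₂]
    exact Abelian.Ext.comp_assoc _ _ _ _ _ rfl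
  obtain ⟨v, hv, h⟩ := exists_ne_zero_map_eq_zero (scalarExt K F T T 2) φ (fun c v => by
    change (Abelian.Ext.mk₀ (j (c • v))).comp ω (zero_add 2) =
      ((Abelian.Ext.mk₀ (j v)).comp ω (zero_add 2)).comp
        (Abelian.Ext.mk₀ (scalarHom K F T c)) (add_zero 2)
    rw [hj, Abelian.Ext.comp_assoc_of_third_deg_zero, hω, Abelian.Ext.mk₀_comp_mk₀_assoc])
    gen hgen hV
  exact ⟨v, hv, exists_lift_of_comp_eq_zero h₁ h₂ (j v) h⟩

/-- The module-theoretic form of `exists_lift_of_span_ext_two`. -/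
lemma exists_linearMap_lift_of_span_ext_two
    (hker : ∀ {X Y : C} (f : X ⟶ Y), ∃ (Z : C) (k : Z ⟶ X),
      LinearMap.range (F.map k).hom = LinearMap.ker (F.map f).hom)
    (hcoker : ∀ {X Y : C} (f : X ⟶ Y), ∃ (Z : C) (k : Y ⟶ Z), Function.Surjective (F.map k) ∧
      LinearMap.ker (F.map k).hom = LinearMap.range (F.map f).hom)
    {T A Q E B : C} {t : F.obj T →ₗ[R] F.obj A} {π : F.obj A →ₗ[R] F.obj Q}
    {f : F.obj Q →ₗ[R] F.obj E} {q : F.obj E →ₗ[R] F.obj B}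
    (ht : Function.Injective t) (hπ : Function.Surjective π) (h₁ : Function.Exact t π)
    (hf : Function.Injective f) (hq : Function.Surjective q) (h₂ : Function.Exact f q)
    {V : Type} [AddCommGroup V] [Module K V] (hV : ¬ FiniteDimensional K V)
    (j : V →+ (F.obj T →ₗ[R] F.obj B)) (hj : ∀ (c : K) v m, j (c • v) m = algebraMap K R c • j v m)
    {n : ℕ} (gen : Fin n → Abelian.Ext T T 2)
    (hgen : ∀ x, ∃ c : Fin n → K, x = ∑ i, scalarExt K F T T 2 (c i) (gen i)) :
    ∃ v ≠ 0, ∃ (N P : C) (i : F.obj N →ₗ[R] F.obj P) (p : F.obj P →ₗ[R] F.obj T)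
      (g : F.obj N →ₗ[R] F.obj A) (s : F.obj P →ₗ[R] F.obj E),
      Function.Injective i ∧ Function.Surjective p ∧ Function.Exact i p ∧
        q ∘ₗ s = j v ∘ₗ p ∧ s ∘ₗ i = f ∘ₗ π ∘ₗ g := by
  have := additive_of_full_of_faithful F
  obtain ⟨_, h₁⟩ := exists_shortExact_of_exact F (F.preimage (ModuleCat.ofHom t))
    (F.preimage (ModuleCat.ofHom π)) (by simpa using ht) (by simpa using hπ) (by simpa using h₁)
  obtain ⟨_, h₂⟩ := exists_shortExact_of_exact F (F.preimage (ModuleCat.ofHom f))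
    (F.preimage (ModuleCat.ofHom q)) (by simpa using hf) (by simpa using hq) (by simpa using h₂)
  let J : V →+ (T ⟶ B) :=
    { toFun v := F.preimage (ModuleCat.ofHom (j v))
      map_zero' := F.map_injective <| by
        rw [F.map_preimage, map_zero, F.map_zero]
        rfl
      map_add' v w := F.map_injective <| by
        rw [F.map_add, F.map_preimage, F.map_preimage, F.map_preimage, map_add]
        rfl }
  have hJ (v : V) : F.map (J v) = ModuleCat.ofHom (j v) := F.map_preimage _
  obtain ⟨v, hv, N, P, i, p, w, h, d, s, hs, hd⟩ := exists_lift_of_span_ext_two F h₁ h₂ hV J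
    (fun c v => F.map_injective <| by
      ext m
      rw [F.map_comp, ModuleCat.comp_apply, map_scalarHom, hJ, hJ]
      exact hj c v m) gen hgen
  have := h.mono_f
  have := h.epi_g
  refine ⟨v, hv, N, P, (F.map i).hom, (F.map p).hom, (F.map d).hom, (F.map s).hom,
    injective_of_mono F hker i, surjective_of_epi F hcoker p, exact_of_shortExact F hcoker h,
    ?_, ?_⟩
  · have := congrArg (fun k => (F.map k).hom) hs
    simpa [hJ] using this
  · have := congrArg (fun k => (F.map k).hom) hd
    simpa [LinearMap.comp_assoc] using this

end Scalars

lemma infinite_cocycleIndex (X : Type) [LinearOrder X] [Infinite X] : Infinite (CocycleIndex X) :=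
  Set.infinite_coe_iff.2 <| Set.Finite.infinite_compl (s := {p : X | IsMax p}) <|
    Set.Subsingleton.finite fun _ hp _ hq =>
      le_antisymm (le_of_not_gt hq.not_lt) (le_of_not_gt hp.not_lt)

section CategoryO

variable (S : RootReductive K g)

/-- The inclusion of category `O` into all modules. -/
abbrev catOIncl : catO S ⥤ ModuleCat.{0} (UEA K g) :=
  ObjectProperty.ι (fun M : ModuleCat (UEA K g) => S.InO M)

variable {S}

/-- The object of category `O` defined by a module. -/
abbrev catOOf {M : Type} [AddCommGroup M] [Module (UEA K g) M] (hM : S.InO M) : catO S :=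
  ⟨ModuleCat.of (UEA K g) M, hM⟩

lemma exists_ker_catO {X Y : catO S} (f : X ⟶ Y) : ∃ (Z : catO S) (k : Z ⟶ X),
    LinearMap.range ((catOIncl S).map k).hom = LinearMap.ker ((catOIncl S).map f).hom :=
  ⟨catOOf (inO_ker X.property f.hom.hom),
    ObjectProperty.homMk (ModuleCat.ofHom (LinearMap.ker f.hom.hom).subtype),
    Submodule.range_subtype _⟩

lemma exists_coker_catO {X Y : catO S} (f : X ⟶ Y) : ∃ (Z : catO S) (k : Y ⟶ Z),
    Function.Surjective ((catOIncl S).map k) ∧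
      LinearMap.ker ((catOIncl S).map k).hom = LinearMap.range ((catOIncl S).map f).hom := by
  let _ : Module K Y.obj := Module.compHom Y.obj (algebraMap K (UEA K g))
  have : IsScalarTower K (UEA K g) Y.obj := ⟨fun c u m => by
    rw [Algebra.smul_def, mul_smul]; rfl⟩
  exact ⟨catOOf (inO_of_surjective Y.property (LinearMap.range f.hom.hom).mkQ
      (Submodule.mkQ_surjective _)),
    ObjectProperty.homMk (ModuleCat.ofHom (LinearMap.range f.hom.hom).mkQ),
    Submodule.mkQ_surjective _, Submodule.ker_mkQ _⟩

namespace MatrixUnits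

variable {X : Type} [LinearOrder X] (M : MatrixUnits S X)

/-- The homomorphism from the trivial module given by a combination of cocycles. -/
def cocyclePoint {T : Type} [AddCommGroup T] [Module (UEA K g) T] (e : T ≃ₗ[UEA K g] TrivMod K) :
    (CocycleIndex X →₀ K) →+ (T →ₗ[UEA K g] M.CocycleMod) where
  toFun v := ueaLinearMap (M.cocycleOf.toLinearMap ∘ₗ LinearMap.toSpanSingleton K _ v ∘ₗ
      (trivOf K).symm.toLinearMap) (fun x m => by
    rw [ι_smul_trivMod, map_zero, ι_smul_cocycleMod]) ∘ₗ e.toLinearMap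
  map_zero' := LinearMap.ext fun _ => by simp
  map_add' v w := LinearMap.ext fun _ => by simp

lemma cocyclePoint_smul {T : Type} [AddCommGroup T] [Module (UEA K g) T]
    (e : T ≃ₗ[UEA K g] TrivMod K) (c : K) (v : CocycleIndex X →₀ K) (m : T) :
    M.cocyclePoint e (c • v) m = algebraMap K (UEA K g) c • M.cocyclePoint e v m := by
  change M.cocycleOf ((trivOf K).symm (e m) • c • v) =
    algebraMap K (UEA K g) c • M.cocycleOf ((trivOf K).symm (e m) • v)
  rw [algebraMap_smul, ← map_smul, smul_comm]

theorem not_exists_span_ext_two (M : MatrixUnits S X) [Infinite X] [Abelian (catO S)]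
    [HasExt.{1} (catO S)]
    (T : catO S) (e : T.obj ≃ₗ[UEA K g] TrivMod K) :
    ¬ ∃ (n : ℕ) (gen : Fin n → Abelian.Ext T T 2), ∀ x : Abelian.Ext T T 2, ∃ c : Fin n → K,
      x = ∑ i, scalarExt K (catOIncl S) T T 2 (c i) (gen i) := by
  rintro ⟨n, gen, hgen⟩
  have := infinite_cocycleIndex X
  have hV : ¬ FiniteDimensional K (CocycleIndex X →₀ K) := fun _ =>
    not_finite_iff_infinite.2 this
      ((Finsupp.basisSingleOne (R := K) (ι := CocycleIndex X)).linearIndependent.finite)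
  obtain ⟨v, hv, N, P, i, p, d, s, hi, hp, hip, hs, hd⟩ :=
    exists_linearMap_lift_of_span_ext_two (catOIncl S) exists_ker_catO exists_coker_catO
      (A := catOOf M.polyMod_inO) (Q := catOOf (M.quotPoly_inO e))
      (E := catOOf (M.quotCocycle_inO e)) (B := catOOf M.cocycleMod_inO)
      (M.trivHom_injective e) (Submodule.mkQ_surjective _)
      (LinearMap.exact_iff.2 (Submodule.ker_mkQ _))
      (quotRangeMap_injective (M.trivHom e) M.polyHom_injective)
      (quotRangeProj_surjective _ _ M.cocycleHom_surjective)
      (exact_quotRangeMap_quotRangeProj _ M.exact_polyHom_cocycleHom)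
      hV (M.cocyclePoint e) (M.cocyclePoint_smul e) gen hgen
  exact hv (M.eq_zero_of_lift e P.property.1 (p := e.toLinearMap ∘ₗ p) hi (e.surjective.comp hp)
    (fun y => e.map_eq_zero_iff.trans (hip y)) d s v (LinearMap.congr_fun hs)
    (LinearMap.congr_fun hd))

end MatrixUnits

end CategoryO

/-- for `g = gl_∞` with either of its two Dynkin Borel subalgebras, the
space `Ext²_O(k, k)` is infinite dimensional over `k`: it is not spanned by finitely
many elements (scalars acting through degree-zero classes of scalar endomorphisms). -/
theorem ext_two_trivial_infinite_dimensional
    (S : RootReductive K (glInf K)) (hD : S.IsDynkin)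
    [Abelian (catO S)] [HasExt.{1} (catO S)]
    (T : catO S) (e : T.obj ≃ₗ[UEA K (glInf K)] TrivMod K) :
    ¬ ∃ (n : ℕ) (gen : Fin n → Abelian.Ext T T 2),
      ∀ x : Abelian.Ext T T 2, ∃ c : Fin n → K,
        x = ∑ i : Fin n, (gen i).comp
          (Abelian.Ext.mk₀
            (ObjectProperty.homMk (ModuleCat.ofHom (e.symm.toLinearMap ∘ₗ trivSmul K (glInf K) (c i) ∘ₗ e.toLinearMap :
              T.obj →ₗ[UEA K (glInf K)] T.obj)) : T ⟶ T))
          (add_zero 2) := by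
  obtain ⟨X, _, _, ⟨M⟩⟩ := exists_matrixUnits_glInf S hD
  rintro ⟨n, gen, hgen⟩
  refine M.not_exists_span_ext_two T e ⟨n, gen, fun x => ?_⟩
  obtain ⟨c, hc⟩ := hgen x
  refine ⟨c, hc.trans (Finset.sum_congr rfl fun i _ => ?_)⟩
  rw [scalarExt_apply]
  congr 2
  refine (catOIncl S).map_injective ?_
  ext m
  rw [map_scalarHom]
  refine e.injective ?_
  rw [map_smul, algebraMap_smul]
  exact e.apply_symm_apply _
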